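/- arXiv:1705.04255 — 2 statements merged into one kernel-verified Lean document; each statement's English description precedes it below -/
import Mathlib

section
/- There exist constants c > 0 and C > 0 such that for every prime p > 2, every quadratic polynomial f(x,y,z) ∈ F_p[x,y,z] that depends on each of the three variables and is not of the form g(h(x) + k(y) + l(z)) for univariate polynomials g, h, k, l over F_p, and every finite sets A, B, C' ⊆ F_p with |A| = |B| ≤ |C'| and |A|·|B|·|C'| ≤ c·p^2, the number of six-tuples (x,y,z,x',y',z') ∈ (A × B × C')^2 with f(x,y,z) = f(x',y',z') is at most C·( (|A||B||C'|)^(3/2) + |A||B||C'|^2 ). -/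
open Finset

section RayBasics
variable {K : Type*} [Field K]

/-- restriction of a polynomial in three variables to the ray `x ↦ (x, b + t x, c + t² x)` -/
noncomputable def rho (r : K × K × K) : MvPolynomial (Fin 3) K →ₐ[K] Polynomial K :=
  MvPolynomial.aeval ![Polynomial.X, Polynomial.C r.2.1 + Polynomial.C r.1 * Polynomial.X,
    Polynomial.C r.2.2 + Polynomial.C (r.1 ^ 2) * Polynomial.X]

theorem rho_X0 (r : K × K × K) : rho r (MvPolynomial.X 0) = Polynomial.X := by simp [rho]
theorem rho_X1 (r : K × K × K) : rho r (MvPolynomial.X 1) =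
    Polynomial.C r.2.1 + Polynomial.C r.1 * Polynomial.X := by simp [rho]
theorem rho_X2 (r : K × K × K) : rho r (MvPolynomial.X 2) =
    Polynomial.C r.2.2 + Polynomial.C (r.1 ^ 2) * Polynomial.X := by simp [rho]
theorem rho_C (r : K × K × K) (a : K) : rho r (MvPolynomial.C a) = Polynomial.C a := by simp [rho]

/-- the point of a ray -/
def rpt (r : K × K × K) (x : K) : Fin 3 → K := ![x, r.2.1 + r.1 * x, r.2.2 + r.1 ^ 2 * x]

theorem eval_rho (r : K × K × K) (x : K) (F : MvPolynomial (Fin 3) K) :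
    (rho r F).eval x = MvPolynomial.eval (rpt r x) F := by
  have h : (Polynomial.evalRingHom x).comp (rho r).toRingHom =
      MvPolynomial.eval (rpt r x) := by
    apply MvPolynomial.ringHom_ext
    · intro a; simp [rho]
    · intro i; fin_cases i <;> simp [rho, rpt]
  exact congrArg (fun g => g F) h

theorem natDegree_rho_le (r : K × K × K) (F : MvPolynomial (Fin 3) K) :
    (rho r F).natDegree ≤ F.totalDegree := by
  rw [rho, MvPolynomial.aeval_def, MvPolynomial.eval₂_eq']
  apply Polynomial.natDegree_sum_le_of_forall_le
  intro m hm
  refine (Polynomial.natDegree_C_mul_le _ _).trans ?_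
  refine le_trans ?_ (MvPolynomial.le_totalDegree hm)
  rw [Finsupp.sum_fintype _ _ (fun _ => rfl)]
  refine (Polynomial.natDegree_prod_le _ _).trans ?_
  apply Finset.sum_le_sum
  intro i _
  refine (Polynomial.natDegree_pow_le).trans ?_
  have : (![Polynomial.X, Polynomial.C r.2.1 + Polynomial.C r.1 * Polynomial.X,
    Polynomial.C r.2.2 + Polynomial.C (r.1 ^ 2) * Polynomial.X] i : Polynomial K).natDegree ≤ 1 := by
    fin_cases i
    · simp
    · simp; compute_degree
    · simp; compute_degree
  calc _ ≤ m i * 1 := Nat.mul_le_mul_left _ this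
    _ = m i := by ring

/-- chain rule along a ray -/
theorem derivative_rho (r : K × K × K) (F : MvPolynomial (Fin 3) K) :
    Polynomial.derivative (rho r F) = rho r (MvPolynomial.pderiv 0 F) +
      Polynomial.C r.1 * rho r (MvPolynomial.pderiv 1 F) +
      Polynomial.C (r.1 ^ 2) * rho r (MvPolynomial.pderiv 2 F) := by
  induction F using MvPolynomial.induction_on with
  | C a => simp
  | add p q hp hq => simp only [map_add, hp, hq]; ring
  | mul_X p i hp =>
    simp only [map_mul, Polynomial.derivative_mul, hp, MvPolynomial.pderiv_mul, map_add]
    fin_cases i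
    · simp [rho_X0, MvPolynomial.pderiv_X]; ring
    · simp [rho_X1, MvPolynomial.pderiv_X]; ring
    · simp [rho_X2, MvPolynomial.pderiv_X, -map_pow]; ring

theorem sum_tri (k : ℕ) : ∑ b ∈ Finset.range (k + 1), (k - b + 1) = (k + 2).choose 2 := by
  have h := Finset.sum_range_reflect (fun j => j + 1) (k + 1)
  have h2 : ∑ b ∈ Finset.range (k + 1), (k - b + 1) = ∑ j ∈ Finset.range (k + 1), (j + 1) := by
    rw [← h]; apply Finset.sum_congr rfl; intro x hx; simp
  rw [h2]
  clear h h2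
  induction k with
  | zero => simp
  | succ k ih => rw [Finset.sum_range_succ, ih, Nat.choose_succ_succ' (k+2) 1]; simp; ring

theorem sum_tet (m : ℕ) : ∑ a ∈ Finset.range (m + 1), (m - a + 2).choose 2 = (m + 3).choose 3 := by
  have h := Finset.sum_range_reflect (fun j => (j + 2).choose 2) (m + 1)
  have h2 : ∑ a ∈ Finset.range (m + 1), (m - a + 2).choose 2 =
      ∑ j ∈ Finset.range (m + 1), (j + 2).choose 2 := by
    rw [← h]; apply Finset.sum_congr rfl; intro x hx; simp
  rw [h2]
  clear h h2
  induction m with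
  | zero => simp
  | succ k ih => rw [Finset.sum_range_succ, ih, Nat.choose_succ_succ' (k+3) 2, add_comm]

theorem card_le3 (m : ℕ) :
    Nat.card {n : Fin 3 →₀ ℕ | (n.sum fun _ e => e) ≤ m} = (m + 3).choose 3 := by
  have e : {n : Fin 3 →₀ ℕ | (n.sum fun _ e => e) ≤ m} ≃
      (Finset.range (m+1)).sigma (fun a => (Finset.range (m - a + 1)).sigma
        (fun b => Finset.range (m - a - b + 1))) :=
    { toFun := fun n => ⟨⟨n.1 0, n.1 1, n.1 2⟩, by
        have := n.2
        simp [Finsupp.sum_fintype, Fin.sum_univ_three] at this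
        simp; omega⟩
      invFun := fun n => ⟨Finsupp.equivFunOnFinite.symm ![n.1.1, n.1.2.1, n.1.2.2], by
        have := n.2
        simp only [Finset.mem_sigma, Finset.mem_range] at this
        simp [Finsupp.sum_fintype, Fin.sum_univ_three]
        omega⟩
      left_inv := by
        intro n
        ext i
        fin_cases i <;> simp
      right_inv := by
        rintro ⟨⟨a, b, c⟩, h⟩
        simp }
  rw [Nat.card_congr e, Nat.card_eq_fintype_card, Fintype.card_coe, Finset.card_sigma]
  simp only [Finset.card_sigma, Finset.card_range]
  simp only [sum_tri]
  exact sum_tet m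

theorem finrank_rtd (m : ℕ) :
    Module.finrank K (MvPolynomial.restrictTotalDegree (Fin 3) K m) = (m + 3).choose 3 := by
  exact (Module.finrank_eq_nat_card_basis (MvPolynomial.basisRestrictSupport K _)).trans (card_le3 m)

theorem exists_vanishing (S : Finset (K × K × K)) (d : ℕ)
    (h : S.card * (d + 1) < (d + 3).choose 3) :
    ∃ F : MvPolynomial (Fin 3) K, F ≠ 0 ∧ F.totalDegree ≤ d ∧ ∀ r ∈ S, rho r F = 0 := by
  let φ : MvPolynomial.restrictTotalDegree (Fin 3) K d →ₗ[K] (S → Fin (d + 1) → K) :=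
    LinearMap.pi fun r => LinearMap.pi fun i =>
      (Polynomial.lcoeff K i) ∘ₗ (rho r.1).toLinearMap ∘ₗ Submodule.subtype _
  have hk : LinearMap.ker φ ≠ ⊥ := by
    apply LinearMap.ker_ne_bot_of_finrank_lt
    rw [finrank_rtd, Module.finrank_pi_fintype]
    simpa using h
  obtain ⟨F, hF, hF0⟩ := Submodule.exists_mem_ne_zero_of_ne_bot hk
  refine ⟨F.1, fun h => hF0 (Subtype.ext h), (MvPolynomial.mem_restrictTotalDegree _ _ _).1 F.2, ?_⟩
  intro r hr
  ext i
  by_cases hi : i < d + 1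
  · have := congrFun (congrFun (LinearMap.mem_ker.1 hF) ⟨r, hr⟩) ⟨i, hi⟩
    simpa [φ] using this
  · rw [Polynomial.coeff_eq_zero_of_natDegree_lt]
    · simp
    · have h1 := natDegree_rho_le r F.1
      have h2 := (MvPolynomial.mem_restrictTotalDegree _ _ _).1 F.2
      omega

/-- separating linear forms -/
theorem exists_sep (r s : K × K × K) (h : r ≠ s) :
    ∃ l : MvPolynomial (Fin 3) K, l.totalDegree ≤ 1 ∧ rho s l = 0 ∧ rho r l ≠ 0 := by
  by_cases h1 : r.2.1 = s.2.1 ∧ r.1 = s.1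
  · refine ⟨MvPolynomial.X 2 - MvPolynomial.C s.2.2 - MvPolynomial.C (s.1 ^ 2) * MvPolynomial.X 0,
      ?_, ?_, ?_⟩
    · refine (MvPolynomial.totalDegree_sub _ _).trans (max_le ?_ ?_)
      · refine (MvPolynomial.totalDegree_sub _ _).trans (max_le ?_ ?_) <;> simp
      · refine (MvPolynomial.totalDegree_mul _ _).trans ?_
        rw [MvPolynomial.totalDegree_C]; simp
    · simp only [map_sub, map_mul, rho_X2, rho_X0, rho_C]; ring
    · simp only [map_sub, rho_X2, rho_X0, map_mul, rho_C]
      intro h2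
      apply h
      have h3 := congrArg (fun q => Polynomial.coeff q 0) h2
      simp [h1, -map_pow] at h3
      exact Prod.ext h1.2 (Prod.ext h1.1 (sub_eq_zero.1 h3))
  · refine ⟨MvPolynomial.X 1 - MvPolynomial.C s.2.1 - MvPolynomial.C s.1 * MvPolynomial.X 0,
      ?_, ?_, ?_⟩
    · refine (MvPolynomial.totalDegree_sub _ _).trans (max_le ?_ ?_)
      · refine (MvPolynomial.totalDegree_sub _ _).trans (max_le ?_ ?_) <;> simp
      · refine (MvPolynomial.totalDegree_mul _ _).trans ?_; simp
    · simp [rho_X1, rho_X0]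
    · simp only [map_sub, rho_X1, rho_X0, map_mul, rho_C]
      intro h2
      apply h1
      have h3 := congrArg (fun q => Polynomial.coeff q 0) h2
      have h4 := congrArg (fun q => Polynomial.coeff q 1) h2
      simp [Polynomial.coeff_C] at h3 h4
      exact ⟨sub_eq_zero.1 h3, sub_eq_zero.1 h4⟩

theorem exists_sep_all (S : Finset (K × K × K)) (r : K × K × K) (hr : r ∉ S) :
    ∃ l : MvPolynomial (Fin 3) K, l.totalDegree ≤ S.card ∧ (∀ s ∈ S, rho s l = 0) ∧
      rho r l ≠ 0 := by
  classical
  induction S using Finset.induction_on with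
  | empty => exact ⟨1, by simp, by simp, by simp⟩
  | insert s S hs ih =>
    simp only [Finset.mem_insert, not_or] at hr
    obtain ⟨l, h1, h2, h3⟩ := ih hr.2
    obtain ⟨l', h1', h2', h3'⟩ := exists_sep r s hr.1
    refine ⟨l * l', ?_, ?_, ?_⟩
    · rw [Finset.card_insert_of_notMem hs]
      exact (MvPolynomial.totalDegree_mul _ _).trans (by omega)
    · intro q hq
      rcases Finset.mem_insert.1 hq with rfl | hq
      · simp [h2']
      · simp [h2 q hq]
    · simp [h3, h3']

end RayBasics

open Finset

section Bezout
variable {K : Type*} [Field K]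

theorem six_choose (k : ℕ) : 6 * (k + 3).choose 3 = (k + 1) * (k + 2) * (k + 3) := by
  induction k with
  | zero => rfl
  | succ n ih =>
    have h2 : 2 * (n + 3).choose 2 = (n + 2) * (n + 3) := by
      clear ih
      induction n with
      | zero => rfl
      | succ n ih =>
        rw [show n + 1 + 3 = (n + 3) + 1 from rfl, Nat.choose_succ_succ' (n+3) 1, Nat.choose_one_right]
        nlinarith
    rw [show n + 1 + 3 = (n + 3) + 1 from rfl, Nat.choose_succ_succ' (n+3) 2]
    nlinarith

theorem bezout_arith (M j e h : ℤ) (he : 0 ≤ e) (hh : 0 ≤ h) (hj : j = M ^ 2 + M) (hj0 : 0 ≤ j)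
    (hcon : e * h < M)
    (key : 6 * (M * (j + e + h + 1 - M)) + (j + h + 1) * (j + h + 2) * (j + h + 3) +
    (j + e + 1) * (j + e + 2) * (j + e + 3) ≤
      (j + e + h + 1) * (j + e + h + 2) * (j + e + h + 3) + (j + 1) * (j + 2) * (j + 3)) : False := by
  have h1 : (j + e + h + 1) * (j + e + h + 2) * (j + e + h + 3) + (j + 1) * (j + 2) * (j + 3) =
    (j + h + 1) * (j + h + 2) * (j + h + 3) + (j + e + 1) * (j + e + 2) * (j + e + 3) +
      3 * (e * h) * (2 * j + e + h + 4) := by ring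
  have h3 : 0 ≤ e * h := mul_nonneg he hh
  have h4 : (e * h) * (2 * j + e + h + 4) ≤ (M - 1) * (2 * j + e + h + 4) := by
    apply mul_le_mul_of_nonneg_right <;> linarith
  have h5 : 0 ≤ (M - 1) * (e + h) := mul_nonneg (by linarith) (by linarith)
  have h6 : 2 * (M * (j + e + h + 1 - M)) ≤ (M - 1) * (2 * j + e + h + 4) := by linarith
  have h7 : 2 * (M * (j + e + h + 1 - M)) - (M - 1) * (2 * j + e + h + 4) =
    (M - 1) * (e + h) + 2 * (e + h) + 2 * j - 2 * (M ^ 2 + M) + 4 := by ring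
  linarith

theorem finrank_map_mulLeft (F : MvPolynomial (Fin 3) K) (hF : F ≠ 0) (n : ℕ) :
    Module.finrank K ((MvPolynomial.restrictTotalDegree (Fin 3) K n).map (LinearMap.mulLeft K F)) =
      (n + 3).choose 3 := by
  rw [← finrank_rtd (K := K) n]
  exact (Submodule.equivMapOfInjective (LinearMap.mulLeft K F)
    (fun a b h => mul_left_cancel₀ hF (by simpa using h)) _).finrank_eq.symm

theorem map_mulLeft_le (F : MvPolynomial (Fin 3) K) (n m : ℕ) (h : F.totalDegree + n ≤ m) :
    (MvPolynomial.restrictTotalDegree (Fin 3) K n).map (LinearMap.mulLeft K F) ≤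
      MvPolynomial.restrictTotalDegree (Fin 3) K m := by
  rintro _ ⟨a, ha, rfl⟩
  rw [SetLike.mem_coe, MvPolynomial.mem_restrictTotalDegree] at ha
  rw [MvPolynomial.mem_restrictTotalDegree]
  exact (MvPolynomial.totalDegree_mul _ _).trans (by omega)

theorem bezout (F D : MvPolynomial (Fin 3) K) (hF : Irreducible F) (hFD : ¬ F ∣ D)
    (S : Finset (K × K × K)) (hS : ∀ r ∈ S, rho r F = 0 ∧ rho r D = 0) :
    S.card ≤ F.totalDegree * D.totalDegree := by
  classical
  have hF0 : F ≠ 0 := hF.ne_zero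
  have hD0 : D ≠ 0 := by rintro rfl; exact hFD (dvd_zero _)
  set e := F.totalDegree with he
  set h := D.totalDegree with hh
  set M := S.card with hM
  set j := M ^ 2 + M with hj
  set m := j + e + h with hm
  let U := (MvPolynomial.restrictTotalDegree (Fin 3) K (j + h)).map (LinearMap.mulLeft K F)
  let V := (MvPolynomial.restrictTotalDegree (Fin 3) K (j + e)).map (LinearMap.mulLeft K D)
  let T := (MvPolynomial.restrictTotalDegree (Fin 3) K j).map (LinearMap.mulLeft K (F * D))
  have hT : U ⊓ V ≤ T := by
    rintro x ⟨⟨a, ha, rfl⟩, ⟨b, hb, hab⟩⟩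
    simp only [LinearMap.mulLeft_apply] at hab ⊢
    have hdv : F ∣ b := by
      have : F ∣ D * b := ⟨a, hab⟩
      exact (hF.prime.dvd_or_dvd this).resolve_left hFD
    obtain ⟨b', rfl⟩ := hdv
    by_cases hb0 : b' = 0
    · subst hb0; rw [← hab]; simp
    · refine ⟨b', ?_, ?_⟩
      · rw [SetLike.mem_coe, MvPolynomial.mem_restrictTotalDegree] at hb ⊢
        rw [MvPolynomial.totalDegree_mul_of_isDomain hF0 hb0] at hb
        omega
      · simp only [LinearMap.mulLeft_apply]; rw [← hab]; ring
  have hex : ∀ r : S, ∃ l : MvPolynomial (Fin 3) K, l.totalDegree ≤ M - 1 ∧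
      (∀ s ∈ S, s ≠ r.1 → rho s l = 0) ∧ rho r.1 l ≠ 0 := by
    intro r
    obtain ⟨l, h1, h2, h3⟩ := exists_sep_all (S.erase r.1) r.1 (by simp)
    refine ⟨l, ?_, fun s hs hsr => h2 s (Finset.mem_erase.2 ⟨hsr, hs⟩), h3⟩
    rwa [Finset.card_erase_of_mem r.2] at h1
  choose G hG1 hG2 hG3 using hex
  let ψ : (S → Fin (m + 1 - M) → K) →ₗ[K] MvPolynomial (Fin 3) K :=
    ∑ r : S, ∑ i : Fin (m + 1 - M),
      (LinearMap.toSpanSingleton K _ (MvPolynomial.X 0 ^ (i : ℕ) * G r)) ∘ₗ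
        (LinearMap.proj i ∘ₗ LinearMap.proj r)
  have hψ : ∀ a, ψ a = ∑ r : S, ∑ i : Fin (m + 1 - M),
      a r i • (MvPolynomial.X 0 ^ (i : ℕ) * G r) := by
    intro a; simp [ψ, LinearMap.sum_apply]
  have hrho : ∀ a, ∀ r : S, rho r.1 (ψ a) =
      (∑ i : Fin (m + 1 - M), Polynomial.C (a r i) * Polynomial.X ^ (i : ℕ)) * rho r.1 (G r) := by
    intro a r
    rw [hψ, map_sum, Finset.sum_eq_single r]
    · rw [map_sum, Finset.sum_mul]
      apply Finset.sum_congr rfl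
      intro i _
      rw [map_smul, map_mul, map_pow, rho_X0, Polynomial.smul_eq_C_mul]; ring
    · intro s _ hsr
      rw [map_sum]
      apply Finset.sum_eq_zero
      intro i _
      rw [map_smul, map_mul, hG2 s r.1 r.2 (fun hh => hsr (Subtype.ext hh.symm))]
      simp
    · simp
  have hinj0 : ∀ a, (∀ r : S, rho r.1 (ψ a) = 0) → a = 0 := by
    intro a ha
    ext r i
    have h1 := ha r
    rw [hrho] at h1
    have h2 := (mul_eq_zero.1 h1).resolve_right (hG3 r)
    have h3 := congrArg (fun q => Polynomial.coeff q (i : ℕ)) h2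
    simp only [Polynomial.finsetSum_coeff, Polynomial.coeff_C_mul_X_pow,
      Polynomial.coeff_zero] at h3
    rw [Finset.sum_eq_single i] at h3
    · simpa using h3
    · intro b _ hb
      rw [if_neg]
      intro hh; exact hb (Fin.ext hh.symm)
    · simp
  have hinj : Function.Injective ψ := by
    rw [← LinearMap.ker_eq_bot, LinearMap.ker_eq_bot']
    intro a ha
    exact hinj0 a (fun r => by rw [ha, map_zero])
  let W := LinearMap.range ψ
  have hWf : Module.finrank K W = M * (m + 1 - M) := by
    rw [LinearMap.finrank_range_of_inj hinj, Module.finrank_pi_fintype]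
    simp [hM]
  have hUV0 : ∀ x ∈ U ⊔ V, ∀ r ∈ S, rho r x = 0 := by
    intro x hx r hr
    obtain ⟨u, ⟨a, _, rfl⟩, v, ⟨b, _, rfl⟩, rfl⟩ := Submodule.mem_sup.1 hx
    simp [(hS r hr).1, (hS r hr).2]
  have hdisj : (U ⊔ V) ⊓ W = ⊥ := by
    rw [eq_bot_iff]
    rintro x ⟨hx, ⟨a, rfl⟩⟩
    have := hinj0 a (fun r => hUV0 _ hx r.1 r.2)
    rw [this]; simp
  have hjM : M ≤ j := by rw [hj]; exact Nat.le_add_left _ _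
  have hle : (U ⊔ V) ⊔ W ≤ MvPolynomial.restrictTotalDegree (Fin 3) K m := by
    refine sup_le (sup_le (map_mulLeft_le _ _ _ (by omega)) (map_mulLeft_le _ _ _ (by omega))) ?_
    rintro _ ⟨a, rfl⟩
    rw [hψ]
    refine Submodule.sum_mem _ fun r _ => Submodule.sum_mem _ fun i _ => Submodule.smul_mem _ _ ?_
    rw [MvPolynomial.mem_restrictTotalDegree]
    refine (MvPolynomial.totalDegree_mul _ _).trans ?_
    rw [MvPolynomial.totalDegree_X_pow]
    have := hG1 r
    have := i.2
    have : 0 < M := Finset.card_pos.2 ⟨r.1, r.2⟩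
    omega
  have : FiniteDimensional K U := inferInstance
  have : FiniteDimensional K V := inferInstance
  have : FiniteDimensional K T := inferInstance
  have : FiniteDimensional K W := inferInstance
  have f1 := Submodule.finrank_sup_add_finrank_inf_eq U V
  have f2 := Submodule.finrank_sup_add_finrank_inf_eq (U ⊔ V) W
  have f3 := Submodule.finrank_mono hle
  have f4 := Submodule.finrank_mono hT
  rw [hdisj, finrank_bot, hWf] at f2
  rw [finrank_rtd] at f3
  rw [finrank_map_mulLeft _ (mul_ne_zero hF0 hD0)] at f4
  rw [finrank_map_mulLeft _ hF0, finrank_map_mulLeft _ hD0] at f1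
  have g1 := six_choose j
  have g2 := six_choose (j + e)
  have g3 := six_choose (j + h)
  have g4 := six_choose m
  obtain ⟨n, hn⟩ : ∃ n, m + 1 = n + M := ⟨m + 1 - M, by omega⟩
  have hn' : m + 1 - M = n := by omega
  rw [hn'] at f2
  have key : 6 * (M * n) + (j + h + 1) * (j + h + 2) * (j + h + 3) +
    (j + e + 1) * (j + e + 2) * (j + e + 3) ≤
      (m + 1) * (m + 2) * (m + 3) + (j + 1) * (j + 2) * (j + 3) := by omega
  by_contra hcon
  push Not at hcon
  refine bezout_arith M j e h (Int.natCast_nonneg _) (Int.natCast_nonneg _) (by exact_mod_cast hj)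
    (Int.natCast_nonneg _) (by exact_mod_cast hcon) ?_
  have hnz : (j : ℤ) + e + h + 1 - M = n := by omega
  rw [hnz]
  clear_value M e h j m
  rw [hm] at key
  exact_mod_cast key

end Bezout

open Finset

section Greedy
open Classical

theorem card_pairs_left {α β : Type*} (R : Finset α) (B : Finset β) (P : α → β → Prop)
    [∀ r l, Decidable (P r l)] :
    ((R ×ˢ B).filter (fun q => P q.1 q.2)).card = ∑ r ∈ R, (B.filter (fun l => P r l)).card := by
  simp only [Finset.card_filter, Finset.sum_product]

theorem card_pairs_right {α β : Type*} (R : Finset α) (B : Finset β) (P : α → β → Prop)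
    [∀ r l, Decidable (P r l)] :
    ((R ×ˢ B).filter (fun q => P q.1 q.2)).card = ∑ l ∈ B, (R.filter (fun r => P r l)).card := by
  simp only [Finset.card_filter, Finset.sum_product_right]

theorem greedy {α β : Type*} (R : Finset α) (B : Finset β) (inc : α → β → Prop) (d θ : ℕ) :
    ∃ R' ⊆ R, θ * R'.card ≤ B.card * (d + 1) ∧
      ((R ×ˢ B).filter (fun q => inc q.1 q.2 ∧
        (R'.filter (fun r => inc r q.2)).card ≤ d)).card ≤ θ * R.card + d * B.card := by
  let Φ : Finset α → ℤ := fun S =>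
    ∑ l ∈ B, ((min (d + 1) (S.filter (fun r => inc r l)).card : ℕ) : ℤ) - θ * S.card
  obtain ⟨R', hR', hmax⟩ := Finset.exists_max_image R.powerset Φ ⟨∅, by simp⟩
  rw [Finset.mem_powerset] at hR'
  refine ⟨R', hR', ?_, ?_⟩
  · have h0 := hmax ∅ (by simp)
    have h1 : Φ ∅ = 0 := by simp [Φ]; right; positivity
    have h2 : Φ R' ≤ B.card * (d + 1) - θ * R'.card := by
      simp only [Φ]
      gcongr
      refine (Finset.sum_le_card_nsmul _ _ ((d : ℤ) + 1) ?_).trans (by simp)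
      intro l _
      exact_mod_cast min_le_left _ _
    rw [h1] at h0
    have : (θ : ℤ) * R'.card ≤ B.card * (d + 1) := by linarith
    exact_mod_cast this
  · rw [card_pairs_left R B (fun r l => inc r l ∧ (R'.filter (fun r => inc r l)).card ≤ d)]
    rw [← Finset.sum_sdiff hR']
    apply add_le_add
    · refine (Finset.sum_le_card_nsmul _ _ θ ?_).trans ?_
      · intro r hr
        rw [Finset.mem_sdiff] at hr
        have h0 := hmax (insert r R') (by
          rw [Finset.mem_powerset]; exact Finset.insert_subset hr.1 hR')
        have h1 : ∀ l ∈ B, ((min (d + 1) (R'.filter (fun r => inc r l)).card : ℕ) : ℤ) +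
            (if inc r l ∧ (R'.filter (fun r => inc r l)).card ≤ d then 1 else 0) ≤
            ((min (d + 1) ((insert r R').filter (fun r => inc r l)).card : ℕ) : ℤ) := by
          intro l _
          rw [Finset.filter_insert]
          by_cases hi : inc r l
          · rw [if_pos hi, Finset.card_insert_of_notMem (by simp [hr.2])]
            split_ifs with h <;> simp [hi] at h <;> omega
          · simp [hi]
        have h2 := Finset.sum_le_sum h1
        rw [Finset.sum_add_distrib] at h2
        have h3 : ∑ l ∈ B, (if inc r l ∧ (R'.filter (fun r => inc r l)).card ≤ d
            then (1 : ℤ) else 0) =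
            ((B.filter (fun l => inc r l ∧ (R'.filter (fun r => inc r l)).card ≤ d)).card : ℤ) := by
          simp
        rw [h3] at h2
        simp only [Φ] at h0
        rw [Finset.card_insert_of_notMem hr.2] at h0
        push_cast at h0 h2
        have : ((B.filter (fun l => inc r l ∧ (R'.filter (fun r => inc r l)).card ≤ d)).card : ℤ)
          ≤ θ := by linarith
        exact_mod_cast this
      · rw [smul_eq_mul, mul_comm]
        gcongr
        exact Finset.sdiff_subset
    · rw [← card_pairs_left R' B (fun r l => inc r l ∧ (R'.filter (fun r => inc r l)).card ≤ d),
        card_pairs_right R' B (fun r l => inc r l ∧ (R'.filter (fun r => inc r l)).card ≤ d)]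
      refine (Finset.sum_le_card_nsmul _ _ d ?_).trans (by rw [smul_eq_mul, mul_comm])
      intro l _
      by_cases h : (R'.filter (fun r => inc r l)).card ≤ d
      · simpa [h] using h
      · simp [h]

end Greedy

open Finset

section ODE
open Polynomial
variable {K : Type*} [Field K]

theorem ode_lemma (p : ℕ) (hp : p.Prime) [CharP K p] (A B : K[X]) (n : ℕ)
    (hA : A.natDegree ≤ n) (hB : B.natDegree ≤ n) (hn : n + 1 < p) (a : K) (ha : A.eval a ≠ 0)
    (hode : A ^ 2 * derivative (derivative B) - A * B * derivative (derivative A) -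
      2 * A * derivative A * derivative B + 2 * (derivative A) ^ 2 * B = 0) :
    ∃ α β : K, B = (C α + C β * X) * A := by
  set l0 := B.eval a / A.eval a with hl0
  set l1 := ((derivative B).eval a - l0 * (derivative A).eval a) / A.eval a with hl1
  set L : K[X] := C l0 + C l1 * (X - C a) with hL
  set D := B - L * A with hD
  have hL' : derivative L = C l1 := by simp [hL]
  have hBD : B = D + L * A := by rw [hD]; ring
  have hD0 : D.eval a = 0 := by
    rw [hD, hL]; simp; rw [hl0]; field_simp; ring
  have hD1 : (derivative D).eval a = 0 := by
    rw [hD, derivative_sub, derivative_mul, hL', hL]; simp; rw [hl1]; field_simp; ring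
  have hodeD : A ^ 2 * derivative (derivative D) - A * D * derivative (derivative A) -
      2 * A * derivative A * derivative D + 2 * (derivative A) ^ 2 * D = 0 := by
    rw [← hode, hBD]
    simp only [derivative_add, derivative_mul, hL', derivative_C]
    ring
  have hdeg : D.natDegree ≤ n + 1 := by
    rw [hD]
    refine (natDegree_sub_le _ _).trans (max_le (by omega) ?_)
    refine natDegree_mul_le.trans ?_
    have : L.natDegree ≤ 1 := by
      rw [hL]; compute_degree
    omega
  by_cases hDz : D = 0
  · refine ⟨l0 - l1 * a, l1, ?_⟩
    rw [hBD, hDz, hL]; simp only [map_sub, map_mul]; ring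
  · exfalso
    have hmul : 1 < D.rootMultiplicity a := (one_lt_rootMultiplicity_iff_isRoot hDz).2 ⟨hD0, hD1⟩
    obtain ⟨G, hG, hnd⟩ := exists_eq_pow_rootMultiplicity_mul_and_not_dvd D hDz a
    obtain ⟨k, hk⟩ : ∃ k, D.rootMultiplicity a = k + 2 := ⟨D.rootMultiplicity a - 2, by omega⟩
    rw [hk] at hG
    have hle : k + 2 ≤ n + 1 := by
      refine le_trans ?_ hdeg
      have h := natDegree_le_of_dvd (pow_rootMultiplicity_dvd D a) hDz
      rwa [natDegree_pow, natDegree_X_sub_C, mul_one, hk] at h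
    have hGa : G.eval a ≠ 0 := by
      intro h; exact hnd (dvd_iff_isRoot.2 h)
    set u := X - C a with hu
    have hu' : derivative u = 1 := by simp [hu]
    have e1 : derivative D = u ^ k * (C ((k : K) + 2) * u * G + u ^ 2 * derivative G) := by
      rw [hG, derivative_mul, derivative_pow, hu', show k + 2 - 1 = k + 1 from rfl]
      simp only [Nat.cast_add, Nat.cast_ofNat, map_add, C_ofNat, map_natCast]
      ring
    have e2 : derivative (derivative D) = u ^ k * (C (((k : K) + 2) * (k + 1)) * G +
        2 * C ((k : K) + 2) * u * derivative G + u ^ 2 * derivative (derivative G)) := by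
      have e1' : derivative D = u ^ (k + 1) * (C ((k : K) + 2) * G + u * derivative G) := by
        rw [e1]; ring
      rw [e1', derivative_mul, derivative_pow, hu']
      simp only [derivative_add, derivative_mul, derivative_C, hu']
      simp only [Nat.cast_add, Nat.cast_one, map_add, map_mul, C_ofNat, map_natCast, map_one, Nat.add_sub_cancel]
      ring
    rw [e2, e1, hG] at hodeD
    have hfac : u ^ k * (A ^ 2 * (C (((k : K) + 2) * (k + 1)) * G +
        2 * C ((k : K) + 2) * u * derivative G + u ^ 2 * derivative (derivative G)) -
        A * (u ^ 2 * G) * derivative (derivative A) - 2 * A * derivative A *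
        (C ((k : K) + 2) * u * G + u ^ 2 * derivative G) + 2 * (derivative A) ^ 2 * (u ^ 2 * G))
        = 0 := by
      rw [← hodeD]; ring
    have hu0 : u ^ k ≠ 0 := pow_ne_zero _ (X_sub_C_ne_zero a)
    have h3 := congrArg (eval a) ((mul_eq_zero.1 hfac).resolve_left hu0)
    have hua : u.eval a = 0 := by simp [hu]
    simp [hua, ha, hGa] at h3
    rcases h3 with h3 | h3
    · have : ((k + 2 : ℕ) : K) = 0 := by push_cast; exact h3
      rw [CharP.cast_eq_zero_iff K p] at this
      exact Nat.not_dvd_of_pos_of_lt (by omega) (by omega) this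
    · have : ((k + 1 : ℕ) : K) = 0 := by push_cast; exact h3
      rw [CharP.cast_eq_zero_iff K p] at this
      exact Nat.not_dvd_of_pos_of_lt (by omega) (by omega) this

end ODE

open Finset

section Flec

section RingDefs
variable {R : Type*} [CommRing R]
def fm2 (q2 g4 : R) : R := q2 ^ 2 * g4
def fm1 (q1 q2 g3 g4 : R) : R := q2 ^ 2 * g3 - q1 * q2 * g4
def fm0 (q0 q1 q2 g2 g3 g4 : R) : R := q2 ^ 2 * g2 - q1 * (q2 * g3 - q1 * g4) - q0 * q2 * g4
def fH1 (q0 q1 q2 g1 g2 g3 g4 : R) : R :=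
  q2 ^ 3 * g1 - q1 * fm0 q0 q1 q2 g2 g3 g4 - q0 * fm1 q1 q2 g3 g4
def fH0 (q0 q1 q2 g0 g2 g3 g4 : R) : R :=
  q2 ^ 3 * g0 - q0 * fm0 q0 q1 q2 g2 g3 g4
theorem f_id (q0 q1 q2 g0 g1 g2 g3 g4 τ : R) :
    q2 ^ 3 * (g0 + τ * g1 + τ ^ 2 * g2 + τ ^ 3 * g3 + τ ^ 4 * g4) =
    (q0 + τ * q1 + τ ^ 2 * q2) * (fm0 q0 q1 q2 g2 g3 g4 + τ * fm1 q1 q2 g3 g4 + τ ^ 2 * fm2 q2 g4) +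
     τ * fH1 q0 q1 q2 g1 g2 g3 g4 + fH0 q0 q1 q2 g0 g2 g3 g4 := by
  simp only [fm0, fm1, fm2, fH1, fH0]; ring
theorem f_id' (q0 q1 q2 g1 g2 g3 g4 τ : R) :
    q2 ^ 3 * (g1 + 2 * τ * g2 + 3 * τ ^ 2 * g3 + 4 * τ ^ 3 * g4) =
    (q1 + 2 * τ * q2) * (fm0 q0 q1 q2 g2 g3 g4 + τ * fm1 q1 q2 g3 g4 + τ ^ 2 * fm2 q2 g4) +
    (q0 + τ * q1 + τ ^ 2 * q2) * (fm1 q1 q2 g3 g4 + 2 * τ * fm2 q2 g4) +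
      fH1 q0 q1 q2 g1 g2 g3 g4 := by
  simp only [fm0, fm1, fm2, fH1]; ring
end RingDefs

variable {K : Type*} [Field K]
open MvPolynomial

theorem pd_comm (i j : Fin 3) (P : MvPolynomial (Fin 3) K) :
    pderiv i (pderiv j P) = pderiv j (pderiv i P) := by
  ext m
  simp only [coeff_pderiv, Finsupp.add_apply]
  by_cases h : i = j
  · subst h; rfl
  · rw [add_right_comm]
    simp [Finsupp.single_apply, h, Ne.symm h, eq_comm]
    ring

noncomputable def V1 (t : K) (P : MvPolynomial (Fin 3) K) : MvPolynomial (Fin 3) K :=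
  pderiv 0 P + C t * pderiv 1 P + C (t ^ 2) * pderiv 2 P

theorem derivative_rho' (r : K × K × K) (P : MvPolynomial (Fin 3) K) :
    Polynomial.derivative (rho r P) = rho r (V1 r.1 P) := by
  rw [derivative_rho, V1]; simp only [map_add, map_mul, rho_C]

theorem pd_V1 (i : Fin 3) (t : K) (P : MvPolynomial (Fin 3) K) :
    pderiv i (V1 t P) = V1 t (pderiv i P) := by
  simp only [V1, map_add, pderiv_C_mul, pd_comm i]

theorem V1_add (t : K) (P Q : MvPolynomial (Fin 3) K) : V1 t (P + Q) = V1 t P + V1 t Q := by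
  simp only [V1, map_add]; ring
theorem V1_Cmul (t a : K) (P : MvPolynomial (Fin 3) K) : V1 t (C a * P) = C a * V1 t P := by
  simp only [V1, pderiv_C_mul]; ring

noncomputable def FH1 (F : MvPolynomial (Fin 3) K) : MvPolynomial (Fin 3) K :=
  fH1 (pderiv 0 F) (pderiv 1 F) (pderiv 2 F) (2 * pderiv 0 (pderiv 1 F))
   (pderiv 1 (pderiv 1 F) + 2 * pderiv 0 (pderiv 2 F)) (2 * pderiv 1 (pderiv 2 F))
   (pderiv 2 (pderiv 2 F))
noncomputable def FH0 (F : MvPolynomial (Fin 3) K) : MvPolynomial (Fin 3) K :=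
  fH0 (pderiv 0 F) (pderiv 1 F) (pderiv 2 F) (pderiv 0 (pderiv 0 F))
   (pderiv 1 (pderiv 1 F) + 2 * pderiv 0 (pderiv 2 F)) (2 * pderiv 1 (pderiv 2 F))
   (pderiv 2 (pderiv 2 F))
noncomputable def FM (t : K) (F : MvPolynomial (Fin 3) K) : MvPolynomial (Fin 3) K :=
  fm0 (pderiv 0 F) (pderiv 1 F) (pderiv 2 F)
   (pderiv 1 (pderiv 1 F) + 2 * pderiv 0 (pderiv 2 F)) (2 * pderiv 1 (pderiv 2 F))
   (pderiv 2 (pderiv 2 F)) + C t * fm1 (pderiv 1 F) (pderiv 2 F) (2 * pderiv 1 (pderiv 2 F))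
   (pderiv 2 (pderiv 2 F)) + C t ^ 2 * fm2 (pderiv 2 F) (pderiv 2 (pderiv 2 F))

theorem V1V1 (t : K) (F : MvPolynomial (Fin 3) K) : V1 t (V1 t F) =
    pderiv 0 (pderiv 0 F) + C t * (2 * pderiv 0 (pderiv 1 F)) +
    C t ^ 2 * (pderiv 1 (pderiv 1 F) + 2 * pderiv 0 (pderiv 2 F)) +
    C t ^ 3 * (2 * pderiv 1 (pderiv 2 F)) + C t ^ 4 * (pderiv 2 (pderiv 2 F)) := by
  rw [V1, pd_V1, pd_V1, pd_V1]
  simp only [V1, map_pow]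
  rw [pd_comm 1 0, pd_comm 2 0, pd_comm 2 1]; ring

theorem flec1 (t : K) (F : MvPolynomial (Fin 3) K) :
    pderiv 2 F ^ 3 * V1 t (V1 t F) = V1 t F * FM t F + C t * FH1 F + FH0 F := by
  rw [V1V1, f_id, FM, FH1, FH0, V1, map_pow]

theorem flec2 (t : K) (F : MvPolynomial (Fin 3) K) :
    pderiv 2 F ^ 3 * (2 * V1 t (pderiv 1 F + C (2 * t) * pderiv 2 F)) =
     (pderiv 1 F + C (2 * t) * pderiv 2 F) * FM t F + V1 t F * (fm1 (pderiv 1 F) (pderiv 2 F)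
      (2 * pderiv 1 (pderiv 2 F)) (pderiv 2 (pderiv 2 F)) +
      2 * C t * fm2 (pderiv 2 F) (pderiv 2 (pderiv 2 F))) + FH1 F := by
  have h := f_id' (pderiv 0 F) (pderiv 1 F) (pderiv 2 F) (2 * pderiv 0 (pderiv 1 F))
   (pderiv 1 (pderiv 1 F) + 2 * pderiv 0 (pderiv 2 F)) (2 * pderiv 1 (pderiv 2 F))
   (pderiv 2 (pderiv 2 F)) (C t)
  have e : (C (2 * t) : MvPolynomial (Fin 3) K) = 2 * C t := by rw [map_mul, map_ofNat]
  have hv : V1 t F = pderiv 0 F + C t * pderiv 1 F + C t ^ 2 * pderiv 2 F := by rw [V1, map_pow]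
  rw [V1_add, V1_Cmul, e, FM, FH1, hv]
  rw [← h]
  simp only [V1, map_pow]
  rw [pd_comm 2 1]
  ring

theorem flec_ode (F N0 N1 : MvPolynomial (Fin 3) K) (h0 : FH0 F = F * N0) (h1 : FH1 F = F * N1)
    (l : K × K × K) (hl : rho l F = 0) (A B : Polynomial K)
    (hA : A = rho l (pderiv 1 F + C (2 * l.1) * pderiv 2 F)) (hB : B = rho l (pderiv 2 F)) :
    B ^ 3 * (A * (A ^ 2 * B.derivative.derivative - A * B * A.derivative.derivative -
      2 * A * A.derivative * B.derivative + 2 * A.derivative ^ 2 * B)) = 0 := by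
  have hQ : rho l (V1 l.1 F) = 0 := by rw [← derivative_rho', hl]; simp
  have hG : rho l (V1 l.1 (V1 l.1 F)) = 0 := by rw [← derivative_rho', hQ]; simp
  have hG' : rho l (V1 l.1 (V1 l.1 (V1 l.1 F))) = 0 := by rw [← derivative_rho', hG]; simp
  have hA' : A.derivative = rho l (V1 l.1 (pderiv 1 F + C (2 * l.1) * pderiv 2 F)) := by
    rw [hA, derivative_rho']
  have hA'' : A.derivative.derivative =
      rho l (V1 l.1 (V1 l.1 (pderiv 1 F + C (2 * l.1) * pderiv 2 F))) := by
    rw [hA', derivative_rho']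
  have hB' : B.derivative = rho l (V1 l.1 (pderiv 2 F)) := by rw [hB, derivative_rho']
  have hB'' : B.derivative.derivative = rho l (V1 l.1 (V1 l.1 (pderiv 2 F))) := by
    rw [hB', derivative_rho']
  have k1 := congrArg (rho l) (flec2 l.1 F)
  rw [h1] at k1
  simp only [map_add (rho l), map_mul (rho l), map_pow, hQ, hl, zero_mul, add_zero] at k1
  have k2 : ∀ i, B ^ 3 * rho l (pderiv i (V1 l.1 (V1 l.1 F))) =
      rho l (pderiv i (V1 l.1 F)) * rho l (FM l.1 F) +
      rho l (pderiv i F) * (Polynomial.C l.1 * rho l N1 + rho l N0) := by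
    intro i
    have h := congrArg (fun P => rho l (pderiv i P)) (flec1 l.1 F)
    rw [h0, h1] at h
    simp only [map_add, pderiv_C_mul, Derivation.leibniz, smul_eq_mul, map_mul, map_pow, hQ, hG, hl,
      zero_mul, add_zero, zero_add, rho_C, ← hB] at h
    linear_combination h
  have c2 : (Polynomial.C (2 * l.1) : Polynomial K) = 2 * Polynomial.C l.1 := by
    rw [map_mul, map_ofNat]
  have dA : A = rho l (pderiv 1 F) + 2 * Polynomial.C l.1 * B := by
    rw [hA, hB, map_add, map_mul, rho_C, c2]
  have dA' : A.derivative = rho l (pderiv 1 (V1 l.1 F)) +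
      2 * Polynomial.C l.1 * rho l (pderiv 2 (V1 l.1 F)) := by
    rw [hA', V1_add, V1_Cmul, map_add, map_mul, rho_C, pd_V1, pd_V1, c2]
  have dA'' : A.derivative.derivative = rho l (pderiv 1 (V1 l.1 (V1 l.1 F))) +
      2 * Polynomial.C l.1 * rho l (pderiv 2 (V1 l.1 (V1 l.1 F))) := by
    rw [hA'', V1_add, V1_Cmul, V1_add, V1_Cmul, map_add, map_mul, rho_C, pd_V1, pd_V1, pd_V1,
      pd_V1, c2]
  rw [← pd_V1] at hB'
  rw [← pd_V1, ← pd_V1] at hB''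
  rw [← hA', rho_C, c2, ← hB, ← dA] at k1
  have hexp : ∀ P, rho l (V1 l.1 P) = rho l (pderiv 0 P) + Polynomial.C l.1 * rho l (pderiv 1 P) +
      Polynomial.C l.1 ^ 2 * rho l (pderiv 2 P) := by
    intro P; simp only [V1, map_add, map_mul, rho_C, map_pow]
  rw [hexp] at hQ hG hG'
  rw [← hB] at hQ
  have k20 := k2 0
  have k21 := k2 1
  have k22 := k2 2
  rw [← hB] at k22
  clear k2 hexp c2 hA hA' hA'' hB
  generalize Polynomial.derivative (Polynomial.derivative A) = A2 at *
  generalize Polynomial.derivative (Polynomial.derivative B) = B2 at *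
  generalize Polynomial.derivative A = A1 at *
  generalize Polynomial.derivative B = B1 at *
  generalize Polynomial.C l.1 = T at *
  generalize rho l (pderiv 0 (V1 l.1 (V1 l.1 F))) = G0 at *
  generalize rho l (pderiv 1 (V1 l.1 (V1 l.1 F))) = G1 at *
  generalize rho l (pderiv 2 (V1 l.1 (V1 l.1 F))) = G2 at *
  generalize rho l (pderiv 0 (V1 l.1 F)) = Q0 at *
  generalize rho l (pderiv 1 (V1 l.1 F)) = Q1 at *
  generalize rho l (pderiv 2 (V1 l.1 F)) = Q2 at *
  generalize rho l (pderiv 0 F) = P0 at *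
  generalize rho l (pderiv 1 F) = P1 at *
  generalize rho l (FM l.1 F) = M at *
  have eG0 : G0 = -(T * G1 + T ^ 2 * G2) := by linear_combination hG'
  have eQ0 : Q0 = -(T * Q1 + T ^ 2 * Q2) := by linear_combination hG
  have eP0 : P0 = -(T * P1 + T ^ 2 * B) := by linear_combination hQ
  have eP1 : P1 = A - 2 * T * B := by linear_combination -dA
  have eQ1 : Q1 = A1 - 2 * T * Q2 := by linear_combination -dA'
  have eG1 : G1 = A2 - 2 * T * G2 := by linear_combination -dA''
  subst eP0 eQ0 eG0
  subst eP1 eQ1 eG1 hB' hB''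
  simp only [map_ofNat] at k1
  linear_combination A * (B ^ 2 * k20 + (B ^ 2 * T - A * B) * k21 +
    (B ^ 2 * T ^ 2 - 2 * T * A * B + A ^ 2) * k22) - (-A * B * A1 + A ^ 2 * B1) * k1
end Flec

open Finset

section FactorClaim
open MvPolynomial
variable {K : Type*} [Field K]

theorem totalDegree_pd (i : Fin 3) (P : MvPolynomial (Fin 3) K) :
    (pderiv i P).totalDegree ≤ P.totalDegree - 1 := by
  refine Finset.sup_le fun m hm => ?_
  rw [mem_support_iff, coeff_pderiv] at hm
  have h1 : m + Finsupp.single i 1 ∈ P.support := by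
    rw [mem_support_iff]; exact left_ne_zero_of_mul hm
  have h2 := le_totalDegree h1
  rw [Finsupp.sum_add_index' (by simp) (by simp), Finsupp.sum_single_index (by simp)] at h2
  omega

theorem exists_pd_ne (p : ℕ) [CharP K p] (P : MvPolynomial (Fin 3) K) (h0 : 0 < P.totalDegree)
    (hp : P.totalDegree < p) : ∃ i, pderiv i P ≠ 0 := by
  have h1 : ¬ P.totalDegree = 0 := by omega
  rw [totalDegree_eq_zero_iff] at h1
  push Not at h1
  obtain ⟨m, hm, i, hi⟩ := h1
  refine ⟨i, fun h => ?_⟩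
  have h2 := congrArg (coeff (m - Finsupp.single i 1)) h
  have h3 : m - Finsupp.single i 1 + Finsupp.single i 1 = m := by
    apply tsub_add_cancel_of_le
    simp; omega
  rw [coeff_pderiv, h3, coeff_zero, mul_eq_zero] at h2
  have hmi : m i ≤ P.totalDegree := by
    refine le_trans ?_ (le_totalDegree hm)
    rw [Finsupp.sum]
    exact Finset.single_le_sum (f := fun j => m j) (fun _ _ => Nat.zero_le _) (by simpa using hi)
  rcases h2 with h2 | h2
  · exact (mem_support_iff.1 hm) h2
  · have : ((m i : ℕ) : K) = 0 := by
      rw [← h2]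
      simp only [Finsupp.tsub_apply, Finsupp.single_eq_same]
      rw [Nat.cast_sub (by omega)]; simp
    rw [CharP.cast_eq_zero_iff K p] at this
    exact Nat.not_dvd_of_pos_of_lt (by omega) (by omega) this

theorem totalDegree_pos_of_irred (F : MvPolynomial (Fin 3) K) (hF : Irreducible F) :
    0 < F.totalDegree := by
  by_contra h
  have h : F.totalDegree = 0 := by omega
  rw [totalDegree_eq_zero_iff_eq_C] at h
  rw [h] at hF
  by_cases h0 : coeff 0 F = 0
  · rw [h0] at hF; simp at hF
  · exact hF.not_isUnit ((isUnit_iff_ne_zero.2 h0).map C)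

theorem td_mul {P Q : MvPolynomial (Fin 3) K} {a b : ℕ} (hP : P.totalDegree ≤ a)
    (hQ : Q.totalDegree ≤ b) : (P * Q).totalDegree ≤ a + b :=
  (totalDegree_mul _ _).trans (add_le_add hP hQ)
theorem td_sub {P Q : MvPolynomial (Fin 3) K} {a : ℕ} (hP : P.totalDegree ≤ a)
    (hQ : Q.totalDegree ≤ a) : (P - Q).totalDegree ≤ a :=
  (totalDegree_sub _ _).trans (max_le hP hQ)
theorem td_add {P Q : MvPolynomial (Fin 3) K} {a : ℕ} (hP : P.totalDegree ≤ a)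
    (hQ : Q.totalDegree ≤ a) : (P + Q).totalDegree ≤ a :=
  (totalDegree_add _ _).trans (max_le hP hQ)
theorem td_two {P : MvPolynomial (Fin 3) K} {a : ℕ} (hP : P.totalDegree ≤ a) :
    (2 * P).totalDegree ≤ a := by rw [two_mul]; exact td_add hP hP

theorem td_fm1 {q1 q2 g3 g4 : MvPolynomial (Fin 3) K} {e : ℕ}
   (h1 : q1.totalDegree ≤ e) (h2 : q2.totalDegree ≤ e)
   (h6 : g3.totalDegree ≤ e) (h7 : g4.totalDegree ≤ e) :
   (fm1 q1 q2 g3 g4).totalDegree ≤ e + e + e := by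
  rw [fm1, pow_two]
  exact td_sub (td_mul (td_mul h2 h2) h6) (td_mul (td_mul h1 h2) h7)
theorem td_fm0 {q0 q1 q2 g2 g3 g4 : MvPolynomial (Fin 3) K} {e : ℕ}
   (h0 : q0.totalDegree ≤ e) (h1 : q1.totalDegree ≤ e) (h2 : q2.totalDegree ≤ e)
   (h5 : g2.totalDegree ≤ e)
   (h6 : g3.totalDegree ≤ e) (h7 : g4.totalDegree ≤ e) :
   (fm0 q0 q1 q2 g2 g3 g4).totalDegree ≤ e + e + e := by
  rw [fm0, pow_two]
  refine td_sub (td_sub (td_mul (td_mul h2 h2) h5) ?_) (td_mul (td_mul h0 h2) h7)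
  rw [add_assoc]
  exact td_mul h1 (td_sub (td_mul h2 h6) (td_mul h1 h7))

theorem td_FH1 (F : MvPolynomial (Fin 3) K) : (FH1 F).totalDegree ≤ 4 * F.totalDegree := by
  have d : ∀ i, (pderiv i F).totalDegree ≤ F.totalDegree := fun i =>
    (totalDegree_pd i F).trans (Nat.sub_le _ _)
  have dd : ∀ i j, (pderiv i (pderiv j F)).totalDegree ≤ F.totalDegree := fun i j =>
    ((totalDegree_pd i _).trans (Nat.sub_le _ _)).trans (d j)
  rw [FH1, fH1, show 4 * F.totalDegree = F.totalDegree + (F.totalDegree + F.totalDegree + F.totalDegree) by ring]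
  refine td_sub (td_sub ?_ ?_) ?_
  · rw [add_comm, pow_three']
    exact td_mul (td_mul (td_mul (d 2) (d 2)) (d 2)) (td_two (dd _ _))
  · exact td_mul (d _) (td_fm0 (d _) (d _) (d _) (td_add (dd _ _) (td_two (dd _ _)))
      (td_two (dd _ _)) (dd _ _))
  · exact td_mul (d _) (td_fm1 (d _) (d _) (td_two (dd _ _)) (dd _ _))

theorem td_FH0 (F : MvPolynomial (Fin 3) K) : (FH0 F).totalDegree ≤ 4 * F.totalDegree := by
  have d : ∀ i, (pderiv i F).totalDegree ≤ F.totalDegree := fun i =>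
    (totalDegree_pd i F).trans (Nat.sub_le _ _)
  have dd : ∀ i j, (pderiv i (pderiv j F)).totalDegree ≤ F.totalDegree := fun i j =>
    ((totalDegree_pd i _).trans (Nat.sub_le _ _)).trans (d j)
  rw [FH0, fH0, show 4 * F.totalDegree = F.totalDegree + (F.totalDegree + F.totalDegree + F.totalDegree) by ring]
  refine td_sub ?_ ?_
  · rw [add_comm, pow_three']
    exact td_mul (td_mul (td_mul (d 2) (d 2)) (d 2)) (dd _ _)
  · exact td_mul (d _) (td_fm0 (d _) (d _) (d _) (td_add (dd _ _) (td_two (dd _ _)))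
      (td_two (dd _ _)) (dd _ _))

/-- two rays meet at the same parameter -/
def meets (r l : K × K × K) : Prop := ∃ x, rpt r x = rpt l x

noncomputable def mx (r l : K × K × K) : K := (l.2.1 - r.2.1) / (r.1 - l.1)

theorem meets_mx {r l : K × K × K} (h : meets r l) (hne : r.1 ≠ l.1) :
    rpt r (mx r l) = rpt l (mx r l) := by
  obtain ⟨x, hx⟩ := h
  have h1 := congrFun hx 1
  simp only [rpt, Matrix.cons_val_one, Matrix.cons_val_zero] at h1
  have : mx r l = x := by
    rw [mx, div_eq_iff (sub_ne_zero.2 hne)]; linear_combination -h1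
  rw [this]; exact hx

theorem card_le_roots {α : Type*} (R : Finset α) (xs : α → K) (P : Polynomial K) (hP : P ≠ 0)
    (hinj : ∀ r ∈ R, ∀ s ∈ R, xs r = xs s → r = s) (hr : ∀ r ∈ R, P.eval (xs r) = 0) :
    R.card ≤ P.natDegree := by
  classical
  rw [← Finset.card_image_of_injOn (f := xs) (fun r hr s hs h => hinj r hr s hs h)]
  refine le_trans (Finset.card_le_card (t := P.roots.toFinset) ?_)
    ((Multiset.toFinset_card_le _).trans (Polynomial.card_roots' P))
  intro x hx
  obtain ⟨r, hr', rfl⟩ := Finset.mem_image.1 hx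
  simp [hP, hr r hr']

open Classical in
theorem factor_claim (p : ℕ) (hp : p.Prime) [CharP K p] (F : MvPolynomial (Fin 3) K)
    (hF : Irreducible F) (he : F.totalDegree < p) :
    ∃ D, ¬ F ∣ D ∧ D.totalDegree ≤ 4 * F.totalDegree ∧ ∀ l, rho l F = 0 → rho l D ≠ 0 →
      ∀ (R : Finset (K × K × K)) (k : ℕ),
      (∀ r ∈ R, rho r F = 0 ∧ meets r l ∧ r.1 ≠ l.1) →
      (∀ r ∈ R, ∀ s ∈ R, meets r s → r = s) →
      (∀ α β : K, (R.filter (fun r => 1 = α * (r.1 - l.1) + β * (l.2.1 - r.2.1))).card ≤ k) →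
      R.card ≤ k + 4 * F.totalDegree := by
  have hinj : ∀ (l) (R : Finset (K × K × K)), (∀ r ∈ R, rho r F = 0 ∧ meets r l ∧ r.1 ≠ l.1) →
      (∀ r ∈ R, ∀ s ∈ R, meets r s → r = s) →
      ∀ r ∈ R, ∀ s ∈ R, mx r l = mx s l → r = s := by
    intro l R h1 h2 r hr s hs h
    apply h2 r hr s hs
    refine ⟨mx r l, ?_⟩
    rw [meets_mx (h1 r hr).2.1 (h1 r hr).2.2, h, meets_mx (h1 s hs).2.1 (h1 s hs).2.2]
  have hV : ∀ r, rho r F = 0 → rho r (V1 r.1 F) = 0 ∧ rho r (V1 r.1 (V1 r.1 F)) = 0 := by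
    intro r hr
    have hQ : rho r (V1 r.1 F) = 0 := by rw [← derivative_rho', hr]; simp
    exact ⟨hQ, by rw [← derivative_rho', hQ]; simp⟩
  have hH : ∀ l r, rho l F = 0 → rho r F = 0 → meets r l → r.1 ≠ l.1 →
      (rho l (FH0 F)).eval (mx r l) = 0 ∧ (rho l (FH1 F)).eval (mx r l) = 0 := by
    intro l r hl hr hm hne
    have hx := meets_mx hm hne
    have key : ∀ s : K × K × K, rho s F = 0 → rpt s (mx r l) = rpt l (mx r l) →
        s.1 * eval (rpt l (mx r l)) (FH1 F) + eval (rpt l (mx r l)) (FH0 F) = 0 := by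
      intro s hs hsx
      have h1 := congrArg (eval (rpt l (mx r l))) (flec1 s.1 F)
      have h2 := congrArg (Polynomial.eval (mx r l)) (hV s hs).1
      have h3 := congrArg (Polynomial.eval (mx r l)) (hV s hs).2
      rw [eval_rho, hsx, Polynomial.eval_zero] at h2 h3
      simp only [map_add, map_mul, h2, h3, eval_C] at h1
      linear_combination -h1
    have k1 := key r hr hx
    have k2 := key l hl rfl
    rw [eval_rho, eval_rho]
    have h1 : eval (rpt l (mx r l)) (FH1 F) = 0 := by
      have : (r.1 - l.1) * eval (rpt l (mx r l)) (FH1 F) = 0 := by linear_combination k1 - k2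
      exact (mul_eq_zero.1 this).resolve_left (sub_ne_zero.2 hne)
    refine ⟨?_, h1⟩
    rw [h1] at k2; simpa using k2
  by_cases c0 : F ∣ FH0 F
  swap
  · refine ⟨FH0 F, c0, td_FH0 F, fun l hl hD R k h1 h2 _ => ?_⟩
    refine le_trans (card_le_roots R (fun r => mx r l) _ hD (hinj l R h1 h2) fun r hr =>
      (hH l r hl (h1 r hr).1 (h1 r hr).2.1 (h1 r hr).2.2).1) ?_
    exact ((natDegree_rho_le l _).trans (td_FH0 F)).trans (by omega)
  by_cases c1 : F ∣ FH1 F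
  swap
  · refine ⟨FH1 F, c1, td_FH1 F, fun l hl hD R k h1 h2 _ => ?_⟩
    refine le_trans (card_le_roots R (fun r => mx r l) _ hD (hinj l R h1 h2) fun r hr =>
      (hH l r hl (h1 r hr).1 (h1 r hr).2.1 (h1 r hr).2.2).2) ?_
    exact ((natDegree_rho_le l _).trans (td_FH1 F)).trans (by omega)
  obtain ⟨N0, hN0⟩ := c0
  obtain ⟨N1, hN1⟩ := c1
  have he0 := totalDegree_pos_of_irred F hF
  obtain ⟨i, hi⟩ := exists_pd_ne p F he0 he
  have hdi := totalDegree_pd i F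
  refine ⟨pderiv i F, ?_, by omega, ?_⟩
  · rintro ⟨Q, hQ⟩
    have hQ0 : Q ≠ 0 := by rintro rfl; exact hi (by rw [hQ, mul_zero])
    rw [hQ, totalDegree_mul_of_isDomain hF.ne_zero hQ0] at hdi
    omega
  intro l hl hD R k h1 h2 hk
  obtain ⟨A, hA⟩ : ∃ A, A = rho l (pderiv 1 F + C (2 * l.1) * pderiv 2 F) := ⟨_, rfl⟩
  obtain ⟨B, hB⟩ : ∃ B, B = rho l (pderiv 2 F) := ⟨_, rfl⟩
  have hode := flec_ode F N0 N1 hN0 hN1 l hl A B hA hB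
  have dA : A.natDegree ≤ F.totalDegree - 1 := by
    rw [hA]
    refine (natDegree_rho_le _ _).trans (td_add (totalDegree_pd _ _) ?_)
    refine (td_mul (a := 0) (by rw [totalDegree_C]) (totalDegree_pd _ _)).trans (by omega)
  have dB : B.natDegree ≤ F.totalDegree - 1 := by
    rw [hB]
    exact (natDegree_rho_le _ _).trans (totalDegree_pd _ _)
  -- the relations at a meeting point
  have hpt : ∀ r ∈ R, A.eval (mx r l) + (r.1 - l.1) * B.eval (mx r l) = 0 ∧
      (A.eval (mx r l) = 0 → (rho l (pderiv i F)).eval (mx r l) = 0) := by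
    intro r hr
    obtain ⟨hrF, hm, hne⟩ := h1 r hr
    have hx := meets_mx hm hne
    have e1 := congrArg (Polynomial.eval (mx r l)) (hV r hrF).1
    have e2 := congrArg (Polynomial.eval (mx r l)) (hV l hl).1
    rw [eval_rho, hx, Polynomial.eval_zero, V1] at e1
    rw [eval_rho, Polynomial.eval_zero, V1] at e2
    simp only [map_add, map_mul, eval_C, map_pow] at e1 e2
    rw [hA, hB, eval_rho, eval_rho, eval_rho]
    simp only [map_add, map_mul, eval_C]
    have g1 : eval (rpt l (mx r l)) (pderiv 1 F) + 2 * l.1 * eval (rpt l (mx r l)) (pderiv 2 F) +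
        (r.1 - l.1) * eval (rpt l (mx r l)) (pderiv 2 F) = 0 := by
      refine (mul_eq_zero.1 (?_ : (r.1 - l.1) * _ = 0)).resolve_left (sub_ne_zero.2 hne)
      linear_combination e1 - e2
    refine ⟨g1, fun h => ?_⟩
    rw [h, zero_add] at g1
    have z2 := (mul_eq_zero.1 g1).resolve_left (sub_ne_zero.2 hne)
    rw [z2, mul_zero, add_zero] at h
    rw [z2, h] at e2
    have z0 : eval (rpt l (mx r l)) (pderiv 0 F) = 0 := by simpa using e2
    fin_cases i
    · exact z0
    · exact h
    · exact z2
  by_cases hA0 : A = 0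
  · refine le_trans (card_le_roots R (fun r => mx r l) _ hD (hinj l R h1 h2) fun r hr =>
      (hpt r hr).2 (by rw [hA0, Polynomial.eval_zero])) ?_
    exact (natDegree_rho_le l _).trans (by omega)
  rw [← Finset.card_filter_add_card_filter_not (s := R) (fun r => A.eval (mx r l) ≠ 0)]
  apply add_le_add
  · by_cases hem : (R.filter (fun r => A.eval (mx r l) ≠ 0)).Nonempty
    · obtain ⟨r0, hr0⟩ := hem
      rw [Finset.mem_filter] at hr0
      have hB0 : B ≠ 0 := by
        rintro rfl
        have := (hpt r0 hr0.1).1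
        simp at this
        exact hr0.2 this
      have hode2 := (mul_eq_zero.1 ((mul_eq_zero.1 hode).resolve_left
        (pow_ne_zero 3 hB0))).resolve_left hA0
      obtain ⟨α, β, hαβ⟩ := ode_lemma p hp A B (F.totalDegree - 1) dA dB (by omega)
        (mx r0 l) hr0.2 hode2
      refine le_trans (Finset.card_le_card ?_) (hk (-α) (-β))
      intro r hr
      rw [Finset.mem_filter] at hr ⊢
      refine ⟨hr.1, ?_⟩
      have h3 := (hpt r hr.1).1
      rw [hαβ] at h3
      simp only [Polynomial.eval_mul, Polynomial.eval_add, Polynomial.eval_C,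
        Polynomial.eval_X] at h3
      have hne := sub_ne_zero.2 (h1 r hr.1).2.2
      have h4 : A.eval (mx r l) * (1 + (r.1 - l.1) * (α + β * mx r l)) = 0 := by
        linear_combination h3
      have h5 := (mul_eq_zero.1 h4).resolve_left hr.2
      have h6 : (r.1 - l.1) * mx r l = l.2.1 - r.2.1 := by
        rw [mx]; field_simp
      linear_combination h5 - β * h6
    · rw [Finset.not_nonempty_iff_eq_empty] at hem
      rw [hem]; simp
  · refine le_trans (card_le_roots _ (fun r => mx r l) A hA0 ?_ ?_) (dA.trans (by omega))
    · intro r hr s hs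
      exact hinj l R h1 h2 r (Finset.mem_filter.1 hr).1 s (Finset.mem_filter.1 hs).1
    · intro r hr
      simpa using (Finset.mem_filter.1 hr).2
end FactorClaim

open Finset

section RayThm
open MvPolynomial
open Classical
variable {K : Type*} [Field K]

theorem exists_factors (F : MvPolynomial (Fin 3) K) (hF : F ≠ 0) :
    ∃ ι : Finset (MvPolynomial (Fin 3) K), (∀ f ∈ ι, Irreducible f) ∧
      ∑ f ∈ ι, f.totalDegree ≤ F.totalDegree ∧
      ∀ l, rho l F = 0 → ∃ f ∈ ι, rho l f = 0 := by
  induction F using WfDvdMonoid.induction_on_irreducible with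
  | zero => exact absurd rfl hF
  | unit u hu =>
    refine ⟨∅, by simp, by simp, fun l hl => ?_⟩
    have := hu.map (rho l)
    rw [hl] at this
    simp at this
  | mul a i ha hi ih =>
    obtain ⟨ι, h1, h2, h3⟩ := ih ha
    refine ⟨insert i ι, ?_, ?_, ?_⟩
    · intro f hf
      rcases Finset.mem_insert.1 hf with rfl | hf
      · exact hi
      · exact h1 f hf
    · rw [totalDegree_mul_of_isDomain hi.ne_zero ha]
      by_cases hiι : i ∈ ι
      · rw [Finset.insert_eq_of_mem hiι]; omega
      · rw [Finset.sum_insert hiι]; omega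
    · intro l hl
      rw [map_mul, mul_eq_zero] at hl
      rcases hl with hl | hl
      · exact ⟨i, by simp, hl⟩
      · obtain ⟨f, hf, hf'⟩ := h3 l hl
        exact ⟨f, by simp [hf], hf'⟩

theorem meets.symm' {r l : K × K × K} (h : meets r l) : meets l r := by
  obtain ⟨x, hx⟩ := h; exact ⟨x, hx.symm⟩

theorem roots_family (r : K × K × K) (ι : Finset (MvPolynomial (Fin 3) K))
    (g : MvPolynomial (Fin 3) K → MvPolynomial (Fin 3) K) (B : Finset (K × K × K))
    (hB : ∀ l ∈ B, ∀ l' ∈ B, meets l l' → l = l')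
    (hm : ∀ l ∈ B, meets l r ∧ l.1 ≠ r.1)
    (h : ∀ l ∈ B, ∃ f ∈ ι, rho r (g f) ≠ 0 ∧ rho l (g f) = 0) :
    B.card ≤ ∑ f ∈ ι, (g f).totalDegree := by
  set ι' := ι.filter (fun f => rho r (g f) ≠ 0) with hι'
  have hP : ∏ f ∈ ι', rho r (g f) ≠ 0 := by
    rw [Finset.prod_ne_zero_iff]
    intro f hf; exact (Finset.mem_filter.1 hf).2
  refine le_trans (card_le_roots B (fun l => mx l r) _ hP ?_ ?_) ?_
  · intro l hl l' hl' hx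
    apply hB l hl l' hl'
    refine ⟨mx l r, ?_⟩
    rw [meets_mx (hm l hl).1 (hm l hl).2, hx, meets_mx (hm l' hl').1 (hm l' hl').2]
  · intro l hl
    obtain ⟨f, hf, h1, h2⟩ := h l hl
    rw [Polynomial.eval_prod]
    refine Finset.prod_eq_zero (i := f) (by simp [hι', hf, h1]) ?_
    rw [eval_rho, ← meets_mx (hm l hl).1 (hm l hl).2, ← eval_rho, h2, Polynomial.eval_zero]
  · refine (Polynomial.natDegree_prod_le _ _).trans ?_
    refine (Finset.sum_le_sum fun f _ => natDegree_rho_le r (g f)).trans ?_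
    exact Finset.sum_le_sum_of_subset (Finset.filter_subset _ _)

theorem pairs_bound_left {α β : Type*} (R : Finset α) (B : Finset β) (P : α → β → Prop) (n : ℕ)
    [∀ r l, Decidable (P r l)]
    (h : ∀ r ∈ R, (B.filter (fun l => P r l)).card ≤ n) :
    ((R ×ˢ B).filter (fun q => P q.1 q.2)).card ≤ n * R.card := by
  rw [card_pairs_left R B P]
  exact (Finset.sum_le_card_nsmul _ _ n h).trans (by rw [smul_eq_mul, mul_comm])

theorem pairs_bound_right {α β : Type*} (R : Finset α) (B : Finset β) (P : α → β → Prop) (n : ℕ)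
    [∀ r l, Decidable (P r l)]
    (h : ∀ l ∈ B, (R.filter (fun r => P r l)).card ≤ n) :
    ((R ×ˢ B).filter (fun q => P q.1 q.2)).card ≤ n * B.card := by
  rw [card_pairs_right R B P]
  exact (Finset.sum_le_card_nsmul _ _ n h).trans (by rw [smul_eq_mul, mul_comm])

theorem bad_bound (ι : Finset (MvPolynomial (Fin 3) K)) (d : ℕ)
    (D : MvPolynomial (Fin 3) K → MvPolynomial (Fin 3) K) (hι : ∀ f ∈ ι, Irreducible f)
    (hd : ∑ f ∈ ι, f.totalDegree ≤ d)
    (hD : ∀ f ∈ ι, ¬ f ∣ D f ∧ (D f).totalDegree ≤ 4 * f.totalDegree) (S : Finset (K × K × K)) :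
    (S.filter (fun r => ∃ f ∈ ι, rho r f = 0 ∧ rho r (D f) = 0)).card ≤ 4 * d ^ 2 := by
  have h1 : S.filter (fun r => ∃ f ∈ ι, rho r f = 0 ∧ rho r (D f) = 0) ⊆
      ι.biUnion (fun f => S.filter (fun r => rho r f = 0 ∧ rho r (D f) = 0)) := by
    intro r hr
    simp only [Finset.mem_filter, Finset.mem_biUnion] at hr ⊢
    obtain ⟨h, f, hf, h2⟩ := hr
    exact ⟨f, hf, h, h2⟩
  refine (Finset.card_le_card h1).trans (Finset.card_biUnion_le.trans ?_)
  calc ∑ f ∈ ι, (S.filter (fun r => rho r f = 0 ∧ rho r (D f) = 0)).card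
      ≤ ∑ f ∈ ι, f.totalDegree * (4 * d) := by
        apply Finset.sum_le_sum
        intro f hf
        refine (bezout f (D f) (hι f hf) (hD f hf).1 _ (fun r hr => (Finset.mem_filter.1 hr).2)).trans ?_
        apply Nat.mul_le_mul_left
        have := Finset.single_le_sum (f := fun f : MvPolynomial (Fin 3) K => f.totalDegree)
          (fun _ _ => Nat.zero_le _) hf
        have := (hD f hf).2
        omega
    _ = (∑ f ∈ ι, f.totalDegree) * (4 * d) := by rw [Finset.sum_mul]
    _ ≤ d * (4 * d) := Nat.mul_le_mul_right _ hd
    _ = 4 * d ^ 2 := by ring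

theorem ray_step (p : ℕ) (hp : p.Prime) [CharP K p] (k N d : ℕ) (hdp : d < p)
    (hN2 : N < 16 * (d + 1) ^ 2)
    (R B : Finset (K × K × K)) (hRN : R.card ≤ N) (hBN : B.card ≤ N)
    (hR : ∀ r ∈ R, ∀ s ∈ R, meets r s → r = s)
    (hB : ∀ r ∈ B, ∀ s ∈ B, meets r s → r = s)
    (hs : ∀ r ∈ R, ∀ l ∈ B, r.1 ≠ l.1)
    (hk : ∀ l ∈ B, ∀ α β : K, (R.filter (fun r => meets r l ∧
      1 = α * (r.1 - l.1) + β * (l.2.1 - r.2.1))).card ≤ k) :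
    ∃ R₁ ⊆ R, ∃ B₁ ⊆ B, R₁.card ≤ 4 * d ^ 2 ∧ B₁.card ≤ 4 * d ^ 2 ∧
      ((R ×ˢ B).filter (fun q => meets q.1 q.2)).card ≤
      ((R₁ ×ˢ B₁).filter (fun q => meets q.1 q.2)).card + (106 * d + 96 + k) * N := by
  obtain ⟨R', hR', hc, hI1⟩ := greedy R B meets d (96 * (d + 1))
  have hsmall : R'.card * (d + 1) < (d + 3).choose 3 := by
    have h6 := six_choose d
    have h1 : 96 * R'.card ≤ B.card := by
      have : (96 * R'.card) * (d + 1) ≤ B.card * (d + 1) := by linarith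
      exact Nat.le_of_mul_le_mul_right this (by omega)
    have h2 : 6 * R'.card < (d + 1) ^ 2 := by omega
    have h3 : 6 * R'.card * (d + 1) < (d + 1) ^ 2 * (d + 1) :=
      Nat.mul_lt_mul_of_pos_right h2 (by omega)
    have h4 : (d + 1) ^ 2 * (d + 1) ≤ (d + 1) * (d + 2) * (d + 3) := by nlinarith
    by_contra hcon
    push Not at hcon
    have : 6 * (d + 3).choose 3 ≤ 6 * (R'.card * (d + 1)) := Nat.mul_le_mul_left _ hcon
    nlinarith
  obtain ⟨F, hF0, hFd, hFv⟩ := exists_vanishing R' d hsmall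
  obtain ⟨ι, hι, hιd, hιz⟩ := exists_factors F hF0
  have hfd : ∑ f ∈ ι, f.totalDegree ≤ d := hιd.trans hFd
  have hfd1 : ∀ f ∈ ι, f.totalDegree ≤ d := fun f hf =>
    (Finset.single_le_sum (f := fun f : MvPolynomial (Fin 3) K => f.totalDegree)
          (fun _ _ => Nat.zero_le _) hf).trans hfd
  have hDex := fun f (hf : f ∈ ι) => factor_claim p hp f (hι f hf) ((hfd1 f hf).trans_lt hdp)
  choose! D hD1 hD2 hD3 using hDex
  choose! fl hfl1 hfl2 using hιz
  -- saturated blue rays lie on F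
  have hsat : ∀ l ∈ B, d < (R'.filter (fun r => meets r l)).card → rho l F = 0 := by
    intro l hl hd
    by_contra hne
    have := roots_family l {F} id (R'.filter (fun r => meets r l))
      (fun r hr s hs => hR r (hR' (Finset.mem_filter.1 hr).1) s (hR' (Finset.mem_filter.1 hs).1))
      (fun r hr => ⟨(Finset.mem_filter.1 hr).2, hs r (hR' (Finset.mem_filter.1 hr).1) l hl⟩)
      (fun r hr => ⟨F, by simp, hne, hFv r (Finset.mem_filter.1 hr).1⟩)
    simp at this
    omega
  let bad := fun r : K × K × K => ∃ f ∈ ι, rho r f = 0 ∧ rho r (D f) = 0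
  refine ⟨R.filter bad, Finset.filter_subset _ _, B.filter bad, Finset.filter_subset _ _,
    bad_bound ι d D hι hfd (fun f hf => ⟨hD1 f hf, hD2 f hf⟩) R,
    bad_bound ι d D hι hfd (fun f hf => ⟨hD1 f hf, hD2 f hf⟩) B, ?_⟩
  let P1 : K × K × K → K × K × K → Prop := fun r l => meets r l ∧
    (R'.filter (fun r => meets r l)).card ≤ d
  let P3 : K × K × K → K × K × K → Prop := fun r l => meets r l ∧ rho l F = 0 ∧ rho r (fl l) ≠ 0
  let P4 : K × K × K → K × K × K → Prop := fun r l => meets r l ∧ rho l F = 0 ∧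
    rho r (fl l) = 0 ∧ rho l (D (fl l)) ≠ 0
  let P5 : K × K × K → K × K × K → Prop := fun r l => meets r l ∧ rho l F = 0 ∧
    rho l (D (fl l)) = 0 ∧ rho r (D (fl l)) ≠ 0
  have hcover : (R ×ˢ B).filter (fun q => meets q.1 q.2) ⊆
      ((R.filter bad) ×ˢ (B.filter bad)).filter (fun q => meets q.1 q.2) ∪
      ((R ×ˢ B).filter (fun q => P1 q.1 q.2) ∪ ((R ×ˢ B).filter (fun q => P3 q.1 q.2) ∪
      ((R ×ˢ B).filter (fun q => P4 q.1 q.2) ∪ (R ×ˢ B).filter (fun q => P5 q.1 q.2)))) := by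
    rintro ⟨r, l⟩ hq
    simp only [Finset.mem_filter, Finset.mem_product] at hq
    obtain ⟨⟨hr, hl⟩, hm⟩ := hq
    simp only [Finset.mem_union, Finset.mem_filter, Finset.mem_product, hr, hl, hm, true_and, P1, P3,
      P4, P5, bad, and_true]
    by_cases h1 : (R'.filter (fun r => meets r l)).card ≤ d
    · right; left; exact h1
    · have hz := hsat l hl (by omega)
      have hf1 := hfl1 l hz
      have hf2 := hfl2 l hz
      by_cases h3 : rho r (fl l) = 0
      · by_cases h4 : rho l (D (fl l)) = 0
        · by_cases h5 : rho r (D (fl l)) = 0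
          · left; exact ⟨⟨fl l, hf1, h3, h5⟩, ⟨fl l, hf1, hf2, h4⟩⟩
          · right; right; right; right; exact ⟨hz, h4, h5⟩
        · right; right; right; left; exact ⟨hz, h3, h4⟩
      · right; right; left; exact ⟨hz, h3⟩
  have hI3 : ((R ×ˢ B).filter (fun q => P3 q.1 q.2)).card ≤ d * R.card := by
    apply pairs_bound_left R B P3
    intro r hr
    refine le_trans (roots_family r ι id _ ?_ ?_ ?_) hfd
    · intro l hl l' hl'
      exact hB l (Finset.mem_filter.1 hl).1 l' (Finset.mem_filter.1 hl').1
    · intro l hl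
      obtain ⟨hl, hl2⟩ := Finset.mem_filter.1 hl
      exact ⟨hl2.1.symm', (hs r hr l hl).symm⟩
    · intro l hl
      obtain ⟨hl, hl2⟩ := Finset.mem_filter.1 hl
      exact ⟨fl l, hfl1 l hl2.2.1, hl2.2.2, hfl2 l hl2.2.1⟩
  have hI5 : ((R ×ˢ B).filter (fun q => P5 q.1 q.2)).card ≤ (4 * d) * R.card := by
    apply pairs_bound_left R B P5
    intro r hr
    refine le_trans (roots_family r ι D _ ?_ ?_ ?_) ?_
    · intro l hl l' hl'
      exact hB l (Finset.mem_filter.1 hl).1 l' (Finset.mem_filter.1 hl').1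
    · intro l hl
      obtain ⟨hl, hl2⟩ := Finset.mem_filter.1 hl
      exact ⟨hl2.1.symm', (hs r hr l hl).symm⟩
    · intro l hl
      obtain ⟨hl, hl2⟩ := Finset.mem_filter.1 hl
      exact ⟨fl l, hfl1 l hl2.2.1, hl2.2.2.2, hl2.2.2.1⟩
    · refine (Finset.sum_le_sum fun f hf => hD2 f hf).trans ?_
      rw [← Finset.mul_sum]
      exact Nat.mul_le_mul_left _ hfd
  have hI4 : ((R ×ˢ B).filter (fun q => P4 q.1 q.2)).card ≤ (k + 4 * d) * B.card := by
    apply pairs_bound_right R B P4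
    intro l hl
    by_cases hz : rho l F = 0 ∧ rho l (D (fl l)) ≠ 0
    · refine le_trans (hD3 (fl l) (hfl1 l hz.1) l (hfl2 l hz.1) hz.2 _ k ?_ ?_ ?_) ?_
      · intro r hr
        obtain ⟨hr, hr2⟩ := Finset.mem_filter.1 hr
        exact ⟨hr2.2.2.1, hr2.1, hs r hr l hl⟩
      · intro r hr s hs
        exact hR r (Finset.mem_filter.1 hr).1 s (Finset.mem_filter.1 hs).1
      · intro α β
        refine le_trans (Finset.card_le_card ?_) (hk l hl α β)
        intro r hr
        rw [Finset.mem_filter, Finset.mem_filter] at hr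
        rw [Finset.mem_filter]
        exact ⟨hr.1.1, hr.1.2.1, hr.2⟩
      · have := hfd1 _ (hfl1 l hz.1)
        omega
    · rw [Finset.filter_eq_empty_iff.2]
      · simp
      · intro r _ h
        exact hz ⟨h.2.1, h.2.2.2⟩
  have hu := Finset.card_le_card hcover
  have u1 := hu.trans (Finset.card_union_le _ _)
  have u2 := Finset.card_union_le ((R ×ˢ B).filter (fun q => P1 q.1 q.2)) ((R ×ˢ B).filter (fun q => P3 q.1 q.2) ∪
      ((R ×ˢ B).filter (fun q => P4 q.1 q.2) ∪ (R ×ˢ B).filter (fun q => P5 q.1 q.2)))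
  have u3 := Finset.card_union_le ((R ×ˢ B).filter (fun q => P3 q.1 q.2))
      ((R ×ˢ B).filter (fun q => P4 q.1 q.2) ∪ (R ×ˢ B).filter (fun q => P5 q.1 q.2))
  have u4 := Finset.card_union_le ((R ×ˢ B).filter (fun q => P4 q.1 q.2))
    ((R ×ˢ B).filter (fun q => P5 q.1 q.2))
  have hI1' : ((R ×ˢ B).filter (fun q => P1 q.1 q.2)).card ≤ 96 * (d + 1) * R.card + d * B.card := hI1
  have v1 : 96 * (d + 1) * R.card ≤ 96 * (d + 1) * N := Nat.mul_le_mul_left _ hRN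
  have v2 : d * B.card ≤ d * N := Nat.mul_le_mul_left _ hBN
  have v3 : d * R.card ≤ d * N := Nat.mul_le_mul_left _ hRN
  have v4 : (4 * d) * R.card ≤ (4 * d) * N := Nat.mul_le_mul_left _ hRN
  have v5 : (k + 4 * d) * B.card ≤ (k + 4 * d) * N := Nat.mul_le_mul_left _ hBN
  have v6 : (106 * d + 96 + k) * N = 96 * (d + 1) * N + d * N + d * N + (4 * d) * N +
    (k + 4 * d) * N := by ring
  rw [v6]
  linarith

end RayThm

open Finset

section RayThm2
open Classical
variable {K : Type*} [Field K]

theorem ray_thm (p : ℕ) (hp : p.Prime) [CharP K p] (k : ℕ) (N : ℕ) : N ≤ p ^ 2 →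
    ∀ R B : Finset (K × K × K), R.card ≤ N → B.card ≤ N →
    (∀ r ∈ R, ∀ s ∈ R, meets r s → r = s) →
    (∀ r ∈ B, ∀ s ∈ B, meets r s → r = s) →
    (∀ r ∈ R, ∀ l ∈ B, r.1 ≠ l.1) →
    (∀ l ∈ B, ∀ α β : K, (R.filter (fun r => meets r l ∧
      1 = α * (r.1 - l.1) + β * (l.2.1 - r.2.1))).card ≤ k) →
    (((R ×ˢ B).filter (fun q => meets q.1 q.2)).card : ℝ) ≤ 250 * (N * √N) + 2 * k * N := by
  induction N using Nat.strong_induction_on with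
  | _ N ih =>
  intro hNp R B hRN hBN hR hB hs hk
  rcases Nat.eq_zero_or_pos N with h0 | h0
  · subst h0
    have : R = ∅ := by rw [← Finset.card_eq_zero]; omega
    subst this; simp
  obtain ⟨s, hs'⟩ : ∃ s, s = Nat.sqrt N := ⟨_, rfl⟩
  obtain ⟨d, hd'⟩ : ∃ d, d = s / 4 := ⟨_, rfl⟩
  have s1 : s * s ≤ N := by rw [hs']; exact Nat.sqrt_le N
  have s2 : N < (s + 1) * (s + 1) := by rw [hs']; exact Nat.lt_succ_sqrt N
  have d1 : 4 * d ≤ s := by omega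
  have d2 : s + 1 ≤ 4 * (d + 1) := by omega
  have hN1 : 16 * d ^ 2 ≤ N := by nlinarith
  have hN2 : N < 16 * (d + 1) ^ 2 := by nlinarith
  have hdp : d < p := by
    have := hp.pos
    by_contra hcon
    push Not at hcon
    nlinarith
  obtain ⟨R₁, hR1, B₁, hB1, cR, cB, hle⟩ :=
    ray_step p hp k N d hdp hN2 R B hRN hBN hR hB hs hk
  have hlt : 4 * d ^ 2 < N := by
    rcases Nat.eq_zero_or_pos d with h | h
    · rw [h]; omega
    · nlinarith
  have hrec := ih (4 * d ^ 2) hlt (by omega) R₁ B₁ cR cB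
    (fun r hr s hs => hR r (hR1 hr) s (hR1 hs)) (fun r hr s hs => hB r (hB1 hr) s (hB1 hs))
    (fun r hr l hl => hs r (hR1 hr) l (hB1 hl))
    (fun l hl α β => (Finset.card_le_card (Finset.filter_subset_filter _ hR1)).trans
      (hk l (hB1 hl) α β))
  have hle' : (((R ×ˢ B).filter (fun q => meets q.1 q.2)).card : ℝ) ≤
      ((R₁ ×ˢ B₁).filter (fun q => meets q.1 q.2)).card + (106 * d + 96 + k) * N := by
    exact_mod_cast hle
  have hsq : √((4 * d ^ 2 : ℕ) : ℝ) = 2 * d := by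
    rw [show ((4 * d ^ 2 : ℕ) : ℝ) = (2 * d) ^ 2 by push_cast; ring]
    exact Real.sqrt_sq (by positivity)
  rw [hsq] at hrec
  push_cast at hrec
  have e1 : 4 * (d : ℝ) ≤ √N := by
    apply Real.le_sqrt_of_sq_le
    have : ((16 * d ^ 2 : ℕ) : ℝ) ≤ N := by exact_mod_cast hN1
    push_cast at this
    nlinarith
  have e2 : (1 : ℝ) ≤ √N := by
    rw [Real.one_le_sqrt]; exact_mod_cast h0
  have e3 : 4 * (4 * (d : ℝ) ^ 2) ≤ N := by
    have : ((16 * d ^ 2 : ℕ) : ℝ) ≤ N := by exact_mod_cast hN1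
    push_cast at this
    linarith
  have e4 : (0 : ℝ) ≤ k := by positivity
  have e5 : (0 : ℝ) ≤ N := by positivity
  have e6 : (0 : ℝ) ≤ d := by positivity
  have f1 : (4 * (d : ℝ) ^ 2) * (2 * d) ≤ (N / 4) * (√N / 2) := by
    apply mul_le_mul <;> first | linarith | positivity
  have f2 : (d : ℝ) * N ≤ √N / 4 * N := by
    apply mul_le_mul_of_nonneg_right _ e5; linarith
  have f3 : (N : ℝ) ≤ √N * N := by nlinarith
  have f4 : (k : ℝ) * (4 * d ^ 2) ≤ k * (N / 4) := by
    apply mul_le_mul_of_nonneg_left _ e4; linarith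
  have f5 : 0 ≤ (k : ℝ) * N := by positivity
  have f6 : 0 ≤ (N : ℝ) * √N := by positivity
  nlinarith

end RayThm2

open Finset

section PointPlane
open Classical

theorem meets_iff {K : Type*} [Field K] (r l : K × K × K) (hne : r.1 ≠ l.1) :
    meets r l ↔ r.2.2 - l.2.2 = (r.1 + l.1) * (r.2.1 - l.2.1) := by
  constructor
  · rintro ⟨x, hx⟩
    have h1 := congrFun hx 1
    have h2 := congrFun hx 2
    simp [rpt] at h1 h2
    linear_combination h2 - (r.1 + l.1) * h1
  · intro h
    have hd : r.1 - l.1 ≠ 0 := sub_ne_zero.2 hne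
    refine ⟨(l.2.1 - r.2.1) / (r.1 - l.1), ?_⟩
    obtain ⟨x, hx⟩ : ∃ x, x = (l.2.1 - r.2.1) / (r.1 - l.1) := ⟨_, rfl⟩
    rw [← hx]
    rw [eq_div_iff hd] at hx
    funext i
    fin_cases i
    · simp [rpt]
    · simp [rpt]; linear_combination hx
    · simp [rpt]; linear_combination (r.1 + l.1) * hx + h

theorem meets_imp {K : Type*} [Field K] (r l : K × K × K) (hm : meets r l) :
    r.2.2 - l.2.2 = (r.1 + l.1) * (r.2.1 - l.2.1) := by
  obtain ⟨x, hx⟩ := hm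
  have h1 := congrFun hx 1
  have h2 := congrFun hx 2
  simp [rpt] at h1 h2
  linear_combination h2 - (r.1 + l.1) * h1

/-- ray of a point -/
def ptRay {F K : Type*} [Field F] [Field K] (i : F →+* K) (lam mu : K) (q : F × F × F) : K × K × K :=
  (i q.2.1, i q.1, i q.1 * i q.2.1 - i q.2.2 - lam * i q.1 - mu * i q.2.1)

/-- ray of a plane -/
def plRay {F K : Type*} [Field F] [Field K] (i : F →+* K) (lam mu : K) (q : F × F × F) : K × K × K :=
  (i q.1 - lam, mu - i q.2.1, (mu - i q.2.1) * (i q.1 - lam) - i q.2.2)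

/-- incidence -/
def onPl {F : Type*} [Field F] (q π : F × F × F) : Prop := π.1 * q.1 + π.2.1 * q.2.1 + q.2.2 = π.2.2

theorem point_plane_gen {F K : Type*} [Field F] [Field K] (i : F →+* K) (lam mu : K)
    (hind : ∀ a b c : F, i a + i b * lam + i c * mu = 0 → a = 0 ∧ b = 0 ∧ c = 0)
    (p : ℕ) (hp : p.Prime) [CharP K p] (k N : ℕ) (hN : N ≤ p ^ 2)
    (Q L : Finset (F × F × F)) (hQ : Q.card ≤ N) (hL : L.card ≤ N)
    (hk1 : (Q.image Prod.fst).card ≤ k)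
    (hk2 : ∀ π ∈ L, ∀ x0 : F, (Q.filter (fun q => onPl q π ∧ q.1 = x0)).card ≤ k) :
    (((Q ×ˢ L).filter (fun q => onPl q.1 q.2)).card : ℝ) ≤ 250 * (N * √N) + 2 * k * N := by
  have i1 : Function.Injective (ptRay i lam mu) := by
    intro q q' h
    simp only [ptRay, Prod.mk.injEq] at h
    obtain ⟨h1, h2, h3⟩ := h
    have e1 := i.injective h1
    have e2 := i.injective h2
    rw [e1, e2] at h3
    have e3 : i q.2.2 = i q'.2.2 := by linear_combination -h3
    exact Prod.ext e2 (Prod.ext e1 (i.injective e3))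
  have i2 : Function.Injective (plRay i lam mu) := by
    intro q q' h
    simp only [plRay, Prod.mk.injEq] at h
    obtain ⟨h1, h2, h3⟩ := h
    have e1 : q.1 = q'.1 := i.injective (by linear_combination h1)
    have e2 : q.2.1 = q'.2.1 := i.injective (by linear_combination -h2)
    rw [e1, e2] at h3
    have e3 : i q.2.2 = i q'.2.2 := by linear_combination -h3
    exact Prod.ext e1 (Prod.ext e2 (i.injective e3))
  have hne : ∀ q π : F × F × F, (ptRay i lam mu q).1 ≠ (plRay i lam mu π).1 := by
    intro q π h
    simp only [ptRay, plRay] at h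
    have := hind (q.2.1 - π.1) 1 0 (by simp only [map_sub, map_one, map_zero]; linear_combination h)
    exact one_ne_zero this.2.1
  have hinc : ∀ q π : F × F × F, meets (ptRay i lam mu q) (plRay i lam mu π) ↔ onPl q π := by
    intro q π
    rw [meets_iff _ _ (hne q π)]
    have : onPl q π ↔ i (π.1 * q.1 + π.2.1 * q.2.1 + q.2.2) = i π.2.2 := i.injective.eq_iff.symm
    rw [this]
    simp only [ptRay, plRay, map_add, map_mul]
    constructor <;> intro h <;> linear_combination -h
  have key := ray_thm (K := K) p hp k N hN (Q.image (ptRay i lam mu)) (L.image (plRay i lam mu))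
    (card_image_le.trans hQ) (card_image_le.trans hL) ?_ ?_ ?_ ?_
  · refine le_trans ?_ key
    norm_cast
    refine Finset.card_le_card_of_injOn (fun q => (ptRay i lam mu q.1, plRay i lam mu q.2)) ?_ ?_
    · intro q hq
      simp only [coe_filter, mem_product, Set.mem_setOf_eq] at hq
      simp only [coe_filter, mem_product, Set.mem_setOf_eq]
      exact ⟨⟨mem_image_of_mem _ hq.1.1, mem_image_of_mem _ hq.1.2⟩, (hinc _ _).2 hq.2⟩
    · intro q _ q' _ h
      simp only [Prod.mk.injEq] at h
      exact Prod.ext (i1 h.1) (i2 h.2)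
  · intro r hr s hs hm
    obtain ⟨q, hq, rfl⟩ := mem_image.1 hr
    obtain ⟨q', hq', rfl⟩ := mem_image.1 hs
    have := meets_imp _ _ hm
    simp only [ptRay] at this
    have := hind (q.1 * q'.2.1 - q'.1 * q.2.1 + (q.2.2 - q'.2.2)) (q.1 - q'.1) (q.2.1 - q'.2.1)
      (by simp only [map_sub, map_add, map_mul]; linear_combination -this)
    obtain ⟨h1, h2, h3⟩ := this
    have e1 := sub_eq_zero.1 h2
    have e2 := sub_eq_zero.1 h3
    have e3 : q.2.2 = q'.2.2 := by rw [e1, e2] at h1; linear_combination h1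
    rw [Prod.ext e1 (Prod.ext e2 e3)]
  · intro r hr s hs hm
    obtain ⟨q, hq, rfl⟩ := mem_image.1 hr
    obtain ⟨q', hq', rfl⟩ := mem_image.1 hs
    have := meets_imp _ _ hm
    simp only [plRay] at this
    have := hind (q'.2.2 - q.2.2 - q.1 * q'.2.1 + q'.1 * q.2.1) (q'.2.1 - q.2.1) (q.1 - q'.1)
      (by simp only [map_sub, map_add, map_mul]; linear_combination this)
    obtain ⟨h1, h2, h3⟩ := this
    have e1 := sub_eq_zero.1 h2
    have e2 := sub_eq_zero.1 h3
    have e3 : q.2.2 = q'.2.2 := by rw [e1, e2] at h1; linear_combination -h1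
    rw [Prod.ext e2 (Prod.ext e1.symm e3)]
  · intro r hr s hs
    obtain ⟨q, hq, rfl⟩ := mem_image.1 hr
    obtain ⟨q', hq', rfl⟩ := mem_image.1 hs
    exact hne _ _
  · intro l hl α β
    obtain ⟨π, hπ, rfl⟩ := mem_image.1 hl
    have hsub : ∀ (P : K × K × K → Prop) (S : F × F × F → Prop) [DecidablePred P] [DecidablePred S],
        (∀ q, P (ptRay i lam mu q) → S q) →
        ((Q.image (ptRay i lam mu)).filter P).card ≤ (Q.filter S).card := by
      intro P S _ _ h
      rw [Finset.filter_image]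
      refine card_image_le.trans (card_le_card ?_)
      intro q hq
      rw [mem_filter] at hq ⊢
      exact ⟨hq.1, h _ hq.2⟩
    refine (hsub (fun r => meets r (plRay i lam mu π) ∧ 1 = α * (r.1 - (plRay i lam mu π).1) + β * ((plRay i lam mu π).2.1 - r.2.1)) (fun q => onPl q π ∧ 1 = α * (i q.2.1 - (i π.1 - lam)) + β * ((mu - i π.2.1) - i q.1))
      (fun q h => ⟨(hinc q π).1 h.1, h.2⟩)).trans ?_
    by_cases hα : α = 0
    · subst hα
      rcases (Q.filter (fun q => onPl q π ∧ 1 = (0:K) * (i q.2.1 - (i π.1 - lam)) + β * ((mu - i π.2.1) - i q.1))).eq_empty_or_nonempty with h0 | ⟨q0, h0⟩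
      · rw [h0]; simp
      · refine le_trans (card_le_card ?_) (hk2 π hπ q0.1)
        intro q hq
        rw [mem_filter] at h0 hq ⊢
        refine ⟨hq.1, hq.2.1, ?_⟩
        have h1 := h0.2.2
        have h2 := hq.2.2
        have hβ : β ≠ 0 := by rintro rfl; simp at h1
        exact i.injective (mul_left_cancel₀ hβ (by linear_combination h2 - h1))
    · refine le_trans (Finset.card_le_card_of_injOn Prod.fst ?_ ?_) hk1
      · intro q hq
        simp only [coe_filter, Set.mem_setOf_eq] at hq
        exact mem_coe.2 (mem_image_of_mem _ hq.1)
      · intro q hq q' hq' h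
        simp only [coe_filter, Set.mem_setOf_eq] at hq hq'
        have h1 := hq.2.2
        have h2 := hq'.2.2
        rw [← h] at h2
        have e2 : q.2.1 = q'.2.1 :=
          i.injective (mul_left_cancel₀ hα (by linear_combination h2 - h1))
        have e3 : q.2.2 = q'.2.2 := by
          have a1 := hq.2.1
          have a2 := hq'.2.1
          simp only [onPl] at a1 a2
          rw [← h, ← e2] at a2
          linear_combination a1 - a2
        exact Prod.ext h (Prod.ext e2 e3)

theorem point_plane (p : ℕ) (hp : p.Prime) (k N : ℕ) (hN : N ≤ p ^ 2)
    (Q L : Finset (ZMod p × ZMod p × ZMod p)) [Fact p.Prime] (hQ : Q.card ≤ N) (hL : L.card ≤ N)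
    (hk1 : (Q.image Prod.fst).card ≤ k)
    (hk2 : ∀ π ∈ L, ∀ x0 : ZMod p, (Q.filter (fun q => onPl q π ∧ q.1 = x0)).card ≤ k) :
    (((Q ×ˢ L).filter (fun q => onPl q.1 q.2)).card : ℝ) ≤ 250 * (N * √N) + 2 * k * N := by
  let K := FractionRing (Polynomial (ZMod p))
  let j : Polynomial (ZMod p) →+* K := algebraMap _ _
  have hj : Function.Injective j := IsFractionRing.injective _ _
  haveI : CharP K p := charP_of_injective_ringHom hj p
  refine point_plane_gen (K := K) (j.comp Polynomial.C) (j Polynomial.X) (j (Polynomial.X ^ 2)) ?_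
    p hp k N hN Q L hQ hL (by convert hk1) (by intro π hπ x0; convert hk2 π hπ x0)
  intro a b c h
  have h' : Polynomial.C a + Polynomial.C b * Polynomial.X + Polynomial.C c * Polynomial.X ^ 2 = 0 := by
    apply hj
    rw [map_zero, ← h]
    simp
  refine ⟨?_, ?_, ?_⟩
  · simpa [Polynomial.coeff_X, Polynomial.coeff_C] using congrArg (fun P => Polynomial.coeff P 0) h'
  · simpa [Polynomial.coeff_X, Polynomial.coeff_C] using congrArg (fun P => Polynomial.coeff P 1) h'
  · simpa [Polynomial.coeff_X, Polynomial.coeff_C] using congrArg (fun P => Polynomial.coeff P 2) h'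

end PointPlane

open Finset

section CoreA
open Classical
variable {F : Type*} [Field F]

theorem quad_roots (A B D : F) (h : A ≠ 0 ∨ B ≠ 0) :
    ∃ S : Finset F, S.card ≤ 2 ∧ ∀ z, A * z ^ 2 + B * z + D = 0 → z ∈ S := by
  let P : Polynomial F := Polynomial.C A * Polynomial.X ^ 2 + Polynomial.C B * Polynomial.X + Polynomial.C D
  have hP : P ≠ 0 := by
    intro h0
    rcases h with h | h
    · apply h
      simpa [P, Polynomial.coeff_X, Polynomial.coeff_C] using congrArg (fun P => Polynomial.coeff P 2) h0
    · apply h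
      simpa [P, Polynomial.coeff_X, Polynomial.coeff_C] using congrArg (fun P => Polynomial.coeff P 1) h0
  refine ⟨P.roots.toFinset, ?_, ?_⟩
  · refine (Multiset.toFinset_card_le _).trans ((Polynomial.card_roots' P).trans ?_)
    exact Polynomial.natDegree_quadratic_le
  · intro z hz
    rw [Multiset.mem_toFinset, Polynomial.mem_roots hP]
    simpa [P, Polynomial.IsRoot] using hz

/-- fibre count -/
theorem card_le_fib {α β : Type*} [DecidableEq β] (S : Finset α) (T : Finset β) (f : α → β) (n : ℕ)
    (hf : ∀ s ∈ S, f s ∈ T) (hn : ∀ t, (S.filter (fun s => f s = t)).card ≤ n) :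
    S.card ≤ n * T.card := by
  exact Finset.card_le_mul_card_image_of_maps_to hf n (fun b _ => hn b)

theorem conic_count [DecidableEq F] (Y Z : Finset F) (m : ℕ) (hY : Y.card ≤ m) (hZ : Z.card ≤ m)
    (c s2 s1 t2 t1 d : F) (h : ¬ (c = 0 ∧ s2 = 0 ∧ s1 = 0 ∧ t2 = 0 ∧ t1 = 0)) :
    ((Y ×ˢ Z).filter (fun q => c * q.1 * q.2 + s2 * q.1 ^ 2 + s1 * q.1 + t2 * q.2 ^ 2 + t1 * q.2 + d = 0)).card
      ≤ 2 * m := by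
  by_cases hs2 : s2 = 0
  · by_cases ht2 : t2 = 0
    · subst hs2 ht2
      by_cases hcs : c = 0 ∧ s1 = 0
      · obtain ⟨rfl, rfl⟩ := hcs
        have ht1 : t1 ≠ 0 := by rintro rfl; simp at h
        have : _ ≤ Y.card := Finset.card_le_card_of_injOn (s := ((Y ×ˢ Z).filter (fun q : F × F => (0:F) * q.1 * q.2 + 0 * q.1 ^ 2 + 0 * q.1 + 0 * q.2 ^ 2 + t1 * q.2 + d = 0))) Prod.fst ?_ ?_
        · omega
        · intro q hq
          simp only [coe_filter, mem_product, Set.mem_ofPred_eq] at hq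
          exact hq.1.1
        · intro q hq q' hq' e
          simp only [coe_filter, mem_product, Set.mem_ofPred_eq] at hq hq'
          exact Prod.ext e (mul_left_cancel₀ ht1 (by linear_combination hq.2 - hq'.2))
      · rw [← Finset.card_filter_add_card_filter_not (fun q : F × F => c * q.2 + s1 = 0)]
        have h1 : ∀ (S : Finset (F × F)), S ⊆ Y ×ˢ Z → (∀ q ∈ S, c * q.2 + s1 = 0) → S.card ≤ m := by
          intro S hS hS2
          refine le_trans (Finset.card_le_card_of_injOn Prod.fst ?_ ?_) hY
          · intro q hq
            exact (mem_product.1 (hS hq)).1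
          · intro q hq q' hq' e
            have e1 := hS2 q hq
            have e2 := hS2 q' hq'
            have hc : c ≠ 0 := by
              rintro rfl
              apply hcs
              simpa using e1
            exact Prod.ext e (mul_left_cancel₀ hc (by linear_combination e1 - e2))
        have h2 : ∀ (S : Finset (F × F)), S ⊆ Y ×ˢ Z → (∀ q ∈ S, c * q.2 + s1 ≠ 0 ∧
            c * q.1 * q.2 + 0 * q.1 ^ 2 + s1 * q.1 + 0 * q.2 ^ 2 + t1 * q.2 + d = 0) → S.card ≤ m := by
          intro S hS hS2
          refine le_trans (Finset.card_le_card_of_injOn Prod.snd ?_ ?_) hZ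
          · intro q hq
            exact (mem_product.1 (hS hq)).2
          · intro q hq q' hq' e
            obtain ⟨e0, e1⟩ := hS2 q hq
            obtain ⟨_, e2⟩ := hS2 q' hq'
            rw [← e] at e2
            exact Prod.ext (mul_left_cancel₀ e0 (by linear_combination e1 - e2)) e
        have := h1 _ ((filter_subset _ _).trans (filter_subset _ _)) (fun q (hq : q ∈ (((Y ×ˢ Z).filter (fun q : F × F => c * q.1 * q.2 + (0:F) * q.1 ^ 2 + s1 * q.1 + 0 * q.2 ^ 2 + t1 * q.2 + d = 0)).filter (fun q : F × F => c * q.2 + s1 = 0))) => (mem_filter.1 hq).2)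
        have := h2 _ ((filter_subset _ _).trans (filter_subset _ _)) (fun q (hq : q ∈ (((Y ×ˢ Z).filter (fun q : F × F => c * q.1 * q.2 + (0:F) * q.1 ^ 2 + s1 * q.1 + 0 * q.2 ^ 2 + t1 * q.2 + d = 0)).filter (fun q : F × F => ¬ (c * q.2 + s1 = 0)))) => ⟨(mem_filter.1 hq).2, (mem_filter.1 (mem_filter.1 hq).1).2⟩)
        omega
    · refine (card_le_fib _ Y Prod.fst 2 ?_ ?_).trans (by omega)
      · intro q hq
        exact (mem_product.1 (mem_filter.1 hq).1).1
      · intro y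
        obtain ⟨S, hS, hS2⟩ := quad_roots t2 (c * y + t1) (s2 * y ^ 2 + s1 * y + d) (Or.inl ht2)
        refine le_trans (Finset.card_le_card_of_injOn Prod.snd ?_ ?_) hS
        · intro q hq
          simp only [coe_filter, mem_filter, mem_product, Set.mem_ofPred_eq] at hq
          obtain ⟨⟨_, e⟩, rfl⟩ := hq
          exact hS2 _ (by linear_combination e)
        · intro q hq q' hq' e
          simp only [coe_filter, mem_filter, mem_product, Set.mem_ofPred_eq] at hq hq'
          exact Prod.ext (hq.2.trans hq'.2.symm) e
  · refine (card_le_fib _ Z Prod.snd 2 ?_ ?_).trans (by omega)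
    · intro q hq
      exact (mem_product.1 (mem_filter.1 hq).1).2
    · intro z
      obtain ⟨S, hS, hS2⟩ := quad_roots s2 (c * z + s1) (t2 * z ^ 2 + t1 * z + d) (Or.inl hs2)
      refine le_trans (Finset.card_le_card_of_injOn Prod.fst ?_ ?_) hS
      · intro q hq
        simp only [coe_filter, mem_filter, mem_product, Set.mem_ofPred_eq] at hq
        obtain ⟨⟨_, e⟩, rfl⟩ := hq
        exact hS2 _ (by linear_combination e)
      · intro q hq q' hq' e
        simp only [coe_filter, mem_filter, mem_product, Set.mem_ofPred_eq] at hq hq'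
        exact Prod.ext e (hq.2.trans hq'.2.symm)

/-- the quadratic form of the problem, with the constant term dropped -/
def phi (a b c r2 r1 s2 s1 t2 t1 : F) (q : F × F × F) : F :=
  r2 * q.1 ^ 2 + r1 * q.1 + q.1 * (a * q.2.1 + b * q.2.2) +
    (c * q.2.1 * q.2.2 + s2 * q.2.1 ^ 2 + s1 * q.2.1 + t2 * q.2.2 ^ 2 + t1 * q.2.2)

theorem bad_count [DecidableEq F] (a b c r2 r1 s2 s1 t2 t1 : F) (ha : a ≠ 0) (L0 : F)
    (hk2 : t2 * a ^ 2 + s2 * b ^ 2 - c * a * b = 0)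
    (hk1 : t1 * a ^ 2 - s1 * a * b + L0 * (c * a - 2 * s2 * b) = 0)
    (X Y Z : Finset F) (m : ℕ) (hZ : Z.card ≤ m) (hXZ : X.card * Z.card ≤ Y.card * m) :
    (((X ×ˢ Y ×ˢ Z) ×ˢ (X ×ˢ Y ×ˢ Z)).filter (fun q =>
      phi a b c r2 r1 s2 s1 t2 t1 q.1 = phi a b c r2 r1 s2 s1 t2 t1 q.2 ∧
      a * q.2.2.1 + b * q.2.2.2 = L0)).card ≤ 2 * (X.card * Y.card * Z.card * m) := by
  have hψ : ∀ y z : F, a * y + b * z = L0 →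
      a ^ 2 * (c * y * z + s2 * y ^ 2 + s1 * y + t2 * z ^ 2 + t1 * z) = s2 * L0 ^ 2 + s1 * a * L0 := by
    intro y z h
    subst h
    linear_combination z ^ 2 * hk2 + z * hk1
  by_cases hr : r2 ≠ 0 ∨ r1 + L0 ≠ 0
  · refine (card_le_fib _ ((X ×ˢ Y ×ˢ Z) ×ˢ Z) (fun q => (q.1, q.2.2.2)) 2 ?_ ?_).trans ?_
    · intro q hq
      simp only [mem_filter, mem_product] at hq ⊢
      tauto
    · rintro ⟨⟨x, y, z⟩, z'⟩
      obtain ⟨S, hS, hS2⟩ := quad_roots (a ^ 2 * r2) (a ^ 2 * (r1 + L0))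
        (s2 * L0 ^ 2 + s1 * a * L0 - a ^ 2 * phi a b c r2 r1 s2 s1 t2 t1 (x, y, z))
        (by rcases hr with h | h
            · left; positivity
            · right; positivity)
      refine le_trans (Finset.card_le_card_of_injOn (fun q => q.2.1) ?_ ?_) hS
      · rintro ⟨q, x', y', z''⟩ hq
        simp only [coe_filter, mem_filter, mem_product, Set.mem_ofPred_eq, Prod.mk.injEq] at hq
        obtain ⟨⟨_, e1, e2⟩, rfl, rfl⟩ := hq
        apply hS2
        have := hψ _ _ e2
        rw [e1]
        simp only [phi]
        linear_combination -this - a ^ 2 * x' * e2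
      · rintro ⟨q, x', y', z''⟩ hq ⟨q2, x2', y2', z2''⟩ hq2 e
        simp only [coe_filter, mem_filter, mem_product, Set.mem_ofPred_eq, Prod.mk.injEq] at hq hq2
        obtain ⟨⟨_, e1, e2⟩, rfl, rfl⟩ := hq
        obtain ⟨⟨_, e1', e2'⟩, rfl, rfl⟩ := hq2
        simp only at e
        subst e
        have : y' = y2' := mul_left_cancel₀ ha (by linear_combination e2 - e2')
        rw [this]
    · simp only [card_product]
      have := Nat.mul_le_mul_left (X.card * Y.card * Z.card) hZ
      nlinarith
  · push Not at hr
    obtain ⟨rfl, hr1⟩ := hr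
    have hr1 : r1 = - L0 := by linear_combination hr1
    subst hr1
    rw [← Finset.card_filter_add_card_filter_not (fun q => a * q.1.2.1 + b * q.1.2.2 = L0)]
    have h1 : ∀ S : Finset ((F × F × F) × (F × F × F)), S ⊆ (X ×ˢ Y ×ˢ Z) ×ˢ (X ×ˢ Y ×ˢ Z) →
        (∀ q ∈ S, a * q.1.2.1 + b * q.1.2.2 = L0 ∧ a * q.2.2.1 + b * q.2.2.2 = L0) →
        S.card ≤ X.card * Y.card * Z.card * m := by
      intro S hS hS2
      have : S.card ≤ ((X ×ˢ Z) ×ˢ (X ×ˢ Z)).card := by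
        refine Finset.card_le_card_of_injOn (fun q => ((q.1.1, q.1.2.2), (q.2.1, q.2.2.2))) ?_ ?_
        · intro q hq
          have := hS hq
          simp only [mem_product, coe_product, Set.mem_prod, mem_coe] at this ⊢
          tauto
        · rintro ⟨⟨x, y, z⟩, x', y', z'⟩ hq ⟨⟨x2, y2, z2⟩, x2', y2', z2'⟩ hq2 e
          simp only [Prod.mk.injEq] at e
          obtain ⟨⟨rfl, rfl⟩, rfl, rfl⟩ := e
          obtain ⟨u1, u2⟩ := hS2 _ hq
          obtain ⟨v1, v2⟩ := hS2 _ hq2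
          simp only at u1 u2 v1 v2
          have : y = y2 := mul_left_cancel₀ ha (by linear_combination u1 - v1)
          have : y' = y2' := mul_left_cancel₀ ha (by linear_combination u2 - v2)
          subst_vars
          rfl
      refine this.trans ?_
      simp only [card_product]
      calc _ ≤ X.card * Z.card * (Y.card * m) := Nat.mul_le_mul_left _ hXZ
        _ = _ := by ring
    have h2 : ∀ S : Finset ((F × F × F) × (F × F × F)), S ⊆ (X ×ˢ Y ×ˢ Z) ×ˢ (X ×ˢ Y ×ˢ Z) →
        (∀ q ∈ S, phi a b c 0 (-L0) s2 s1 t2 t1 q.1 = phi a b c 0 (-L0) s2 s1 t2 t1 q.2 ∧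
          a * q.1.2.1 + b * q.1.2.2 ≠ L0 ∧ a * q.2.2.1 + b * q.2.2.2 = L0) →
        S.card ≤ X.card * Y.card * Z.card * m := by
      intro S hS hS2
      have : S.card ≤ ((Y ×ˢ Z) ×ˢ (X ×ˢ Z)).card := by
        refine Finset.card_le_card_of_injOn (fun q => (q.1.2, (q.2.1, q.2.2.2))) ?_ ?_
        · intro q hq
          have := hS hq
          simp only [mem_product, coe_product, Set.mem_prod, mem_coe] at this ⊢
          tauto
        · rintro ⟨⟨x, y, z⟩, x', y', z'⟩ hq ⟨⟨x2, y2, z2⟩, x2', y2', z2'⟩ hq2 e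
          simp only [Prod.mk.injEq] at e
          obtain ⟨⟨rfl, rfl⟩, rfl, rfl⟩ := e
          obtain ⟨u1, u2, u3⟩ := hS2 _ hq
          obtain ⟨v1, v2, v3⟩ := hS2 _ hq2
          simp only [phi] at u1 u2 u3 v1 v2 v3
          have h3 : y' = y2' := mul_left_cancel₀ ha (by linear_combination u3 - v3)
          subst h3
          have : x = x2 := mul_left_cancel₀ (sub_ne_zero.2 u2) (by linear_combination u1 - v1)
          subst_vars
          rfl
      refine this.trans ?_
      simp only [card_product]
      calc _ = X.card * Y.card * Z.card * Z.card := by ring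
        _ ≤ _ := Nat.mul_le_mul_left _ hZ
    have a1 := h1 _ ((filter_subset _ _).trans (filter_subset _ _)) (fun q (hq : q ∈ ((((X ×ˢ Y ×ˢ Z) ×ˢ (X ×ˢ Y ×ˢ Z)).filter (fun q =>
      phi a b c 0 (-L0) s2 s1 t2 t1 q.1 = phi a b c 0 (-L0) s2 s1 t2 t1 q.2 ∧
      a * q.2.2.1 + b * q.2.2.2 = L0)).filter (fun q => a * q.1.2.1 + b * q.1.2.2 = L0))) =>
        ⟨(mem_filter.1 hq).2, (mem_filter.1 (mem_filter.1 hq).1).2.2⟩)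
    have a2 := h2 _ ((filter_subset _ _).trans (filter_subset _ _)) (fun q (hq : q ∈ ((((X ×ˢ Y ×ˢ Z) ×ˢ (X ×ˢ Y ×ˢ Z)).filter (fun q =>
      phi a b c 0 (-L0) s2 s1 t2 t1 q.1 = phi a b c 0 (-L0) s2 s1 t2 t1 q.2 ∧
      a * q.2.2.1 + b * q.2.2.2 = L0)).filter (fun q => ¬ (a * q.1.2.1 + b * q.1.2.2 = L0)))) =>
        ⟨(mem_filter.1 (mem_filter.1 hq).1).2.1, (mem_filter.1 hq).2, (mem_filter.1 (mem_filter.1 hq).1).2.2⟩)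
    omega

end CoreA

open Finset

section CoreB
open Classical

theorem good_fib {F : Type*} [Field F] (a b c s2 s1 t2 t1 : F) (ha : a ≠ 0) (L e : F)
    (h : t2 * a ^ 2 + s2 * b ^ 2 - c * a * b ≠ 0 ∨
      t1 * a ^ 2 - s1 * a * b + L * (c * a - 2 * s2 * b) ≠ 0) :
    ∃ S : Finset F, S.card ≤ 2 ∧ ∀ y z, a * y + b * z = L →
      c * y * z + s2 * y ^ 2 + s1 * y + t2 * z ^ 2 + t1 * z = e → z ∈ S := by
  obtain ⟨S, hS, hS2⟩ := quad_roots (t2 * a ^ 2 + s2 * b ^ 2 - c * a * b)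
    (t1 * a ^ 2 - s1 * a * b + L * (c * a - 2 * s2 * b)) (s2 * L ^ 2 + s1 * a * L - a ^ 2 * e) h
  refine ⟨S, hS, fun y z h1 h2 => hS2 z ?_⟩
  subst h1 h2
  ring

theorem core (p : ℕ) (hp : p.Prime) [Fact p.Prime] (a b c r2 r1 s2 s1 t2 t1 : ZMod p) (ha : a ≠ 0)
    (hnd : ¬ (c * a = 2 * s2 * b ∧ t1 * a = s1 * b ∧ t2 * a ^ 2 = s2 * b ^ 2))
    (X Y Z : Finset (ZMod p)) (m : ℕ) (hX : X.card ≤ m) (hY : Y.card ≤ m) (hZ : Z.card ≤ m)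
    (hXZ : X.card * Z.card ≤ Y.card * m) (N : ℕ) (hNe : N = X.card * Y.card * Z.card)
    (hN : N ≤ p ^ 2) :
    ((((X ×ˢ Y ×ˢ Z) ×ˢ (X ×ˢ Y ×ˢ Z)).filter (fun q =>
      phi a b c r2 r1 s2 s1 t2 t1 q.1 = phi a b c r2 r1 s2 s1 t2 t1 q.2)).card : ℝ)
      ≤ 1000 * (N * √N) + 20 * (N * m) := by
  obtain ⟨bad, hbad⟩ : ∃ bad : ZMod p → Prop, bad = fun L =>
    t2 * a ^ 2 + s2 * b ^ 2 - c * a * b = 0 ∧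
      t1 * a ^ 2 - s1 * a * b + L * (c * a - 2 * s2 * b) = 0 := ⟨_, rfl⟩
  have huniq : ∀ L L', bad L → bad L' → L = L' := by
    intro L L' h h'
    rw [hbad] at h h'
    by_contra hne
    apply hnd
    have e1 : c * a - 2 * s2 * b = 0 := by
      apply mul_left_cancel₀ (sub_ne_zero.2 hne)
      linear_combination h.2 - h'.2
    refine ⟨by linear_combination e1, ?_, by linear_combination h.1 + b * e1⟩
    apply mul_left_cancel₀ ha
    linear_combination h.2 - L * e1
  obtain ⟨φ, hφ⟩ : ∃ φ, φ = phi a b c r2 r1 s2 s1 t2 t1 := ⟨_, rfl⟩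
  obtain ⟨ψ, hψ⟩ : ∃ ψ : ZMod p → ZMod p → ZMod p, ψ = fun y z => c * y * z + s2 * y ^ 2 + s1 * y + t2 * z ^ 2 + t1 * z := ⟨_, rfl⟩
  have hfib : ∀ L e, ¬ bad L → ∃ S : Finset (ZMod p), S.card ≤ 2 ∧ ∀ y z, a * y + b * z = L →
      ψ y z = e → z ∈ S := by
    intro L e h
    rw [hψ]
    apply good_fib a b c s2 s1 t2 t1 ha L e
    rw [hbad] at h
    tauto
  have hφψ : ∀ x y z, φ (x, y, z) = r2 * x ^ 2 + r1 * x + x * (a * y + b * z) + ψ y z := by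
    intro x y z; rw [hφ, hψ]; rfl
  rw [← hφ]
  obtain ⟨T, hT⟩ : ∃ T, T = X ×ˢ Y ×ˢ Z := ⟨_, rfl⟩
  have hTc : T.card = N := by rw [hT, hNe]; simp only [card_product]; ring
  rw [← hT]
  -- bad parts
  have hb1 : ((T ×ˢ T).filter (fun q => φ q.1 = φ q.2 ∧ bad (a * q.2.2.1 + b * q.2.2.2))).card ≤ 2 * (N * m) := by
    by_cases hex : ∃ L0, bad L0
    · obtain ⟨L0, h0⟩ := hex
      have h0' := h0
      rw [hbad] at h0'
      have := bad_count a b c r2 r1 s2 s1 t2 t1 ha L0 h0'.1 h0'.2 X Y Z m hZ hXZ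
      rw [← hφ, ← hT, ← hNe] at this
      refine le_trans (card_le_card ?_) this
      intro q hq
      rw [mem_filter] at hq
      refine (@mem_filter _ _ _ _ _).2 ?_
      exact ⟨hq.1, hq.2.1, huniq _ _ hq.2.2 h0⟩
    · push Not at hex
      simp [hex]
  have hb2 : ((T ×ˢ T).filter (fun q => φ q.1 = φ q.2 ∧ bad (a * q.1.2.1 + b * q.1.2.2))).card ≤ 2 * (N * m) := by
    refine le_trans (Finset.card_le_card_of_injOn Prod.swap ?_ Prod.swap_injective.injOn) hb1
    intro q hq
    simp only [coe_filter, mem_product, Set.mem_ofPred_eq, Prod.fst_swap, Prod.snd_swap] at hq ⊢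
    exact ⟨⟨hq.1.2, hq.1.1⟩, hq.2.1.symm, hq.2.2⟩
  -- good part
  obtain ⟨G, hG⟩ : ∃ G, G = (T ×ˢ T).filter (fun q => φ q.1 = φ q.2 ∧ ¬ bad (a * q.1.2.1 + b * q.1.2.2) ∧ ¬ bad (a * q.2.2.1 + b * q.2.2.2)) := ⟨_, rfl⟩
  have hsplit : ((T ×ˢ T).filter (fun q => φ q.1 = φ q.2)).card ≤ G.card + 2 * (N * m) + 2 * (N * m) := by
    refine le_trans (card_le_card ?_) ((card_union_le (G ∪ _) _).trans (Nat.add_le_add ((card_union_le _ _).trans (Nat.add_le_add_left hb1 _)) hb2))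
    intro q hq
    rw [hG]
    simp only [mem_union, mem_filter] at hq ⊢
    tauto
  obtain ⟨pt, hpt⟩ : ∃ pt : ZMod p → ZMod p → ZMod p → ZMod p × ZMod p × ZMod p, pt = fun x y' z' => (x, a * y' + b * z', r2 * x ^ 2 + r1 * x - ψ y' z') := ⟨_, rfl⟩
  obtain ⟨pl, hpl⟩ : ∃ pl : ZMod p → ZMod p → ZMod p → ZMod p × ZMod p × ZMod p, pl = fun x' y z => (a * y + b * z, -x', r2 * x' ^ 2 + r1 * x' - ψ y z) := ⟨_, rfl⟩
  have hinc : ∀ x y z x' y' z', φ (x, y, z) = φ (x', y', z') → onPl (pt x y' z') (pl x' y z) := by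
    intro x y z x' y' z' h
    rw [hφψ, hφψ] at h
    simp only [onPl, hpt, hpl]
    linear_combination h
  obtain ⟨Q, hQ⟩ : ∃ Q, Q = T.image (fun q => pt q.1 q.2.1 q.2.2) := ⟨_, rfl⟩
  obtain ⟨L, hL⟩ : ∃ L, L = T.image (fun q => pl q.1 q.2.1 q.2.2) := ⟨_, rfl⟩
  have hI := point_plane p hp (2 * m) N hN Q L (by rw [hQ, ← hTc]; exact card_image_le)
    (by rw [hL, ← hTc]; exact card_image_le) ?_ ?_
  · have hG4 : G.card ≤ 4 * ((Q ×ˢ L).filter (fun q => onPl q.1 q.2)).card := by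
      refine card_le_fib G _ (fun q => (pt q.1.1 q.2.2.1 q.2.2.2, pl q.2.1 q.1.2.1 q.1.2.2)) 4 ?_ ?_
      · rintro ⟨⟨x, y, z⟩, x', y', z'⟩ hq
        rw [hG, mem_filter] at hq
        obtain ⟨h1, h2, h3⟩ := hq
        rw [mem_filter]
        refine ⟨?_, hinc _ _ _ _ _ _ h2⟩
        rw [hT] at h1
        simp only [mem_product] at h1
        rw [hQ, hL, hT, mem_product]
        refine ⟨mem_image.2 ⟨(x, y', z'), ?_, rfl⟩, mem_image.2 ⟨(x', y, z), ?_, rfl⟩⟩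
        · simp only [mem_product]; tauto
        · simp only [mem_product]; tauto
      · rintro ⟨⟨u1, u2, u3⟩, v1, v2, v3⟩
        by_cases hg : ¬ bad u2 ∧ ¬ bad v1
        · obtain ⟨S, hS, hS2⟩ := hfib u2 (r2 * u1 ^ 2 + r1 * u1 - u3) hg.1
          obtain ⟨S', hS', hS2'⟩ := hfib v1 (r2 * (-v2) ^ 2 + r1 * (-v2) - v3) hg.2
          have : (S ×ˢ S').card ≤ 4 := by
            rw [card_product]
            calc _ ≤ 2 * 2 := Nat.mul_le_mul hS hS'
              _ = 4 := rfl
          refine le_trans (Finset.card_le_card_of_injOn (fun q => (q.2.2.2, q.1.2.2)) ?_ ?_) this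
          · rintro ⟨⟨x, y, z⟩, x', y', z'⟩ hq
            simp only [coe_filter, Set.mem_ofPred_eq, hpt, hpl, Prod.mk.injEq] at hq
            obtain ⟨-, ⟨rfl, rfl, rfl⟩, rfl, rfl, rfl⟩ := hq
            simp only [coe_product, Set.mem_prod, mem_coe]
            exact ⟨hS2 _ _ rfl (by ring), hS2' _ _ rfl (by ring)⟩
          · rintro ⟨⟨x, y, z⟩, x', y', z'⟩ hq ⟨⟨x2, y2, z2⟩, x2', y2', z2'⟩ hq2 e
            simp only [coe_filter, Set.mem_ofPred_eq, hpt, hpl, Prod.mk.injEq] at hq hq2 e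
            obtain ⟨-, ⟨rfl, rfl, rfl⟩, rfl, rfl, rfl⟩ := hq
            obtain ⟨-, ⟨e1, e2, e3⟩, e4, e5, e6⟩ := hq2
            obtain ⟨rfl, rfl⟩ := e
            have : y = y2 := mul_left_cancel₀ ha (by linear_combination -e4)
            have : y' = y2' := mul_left_cancel₀ ha (by linear_combination -e2)
            have : x' = x2' := by linear_combination e5
            subst_vars
            rfl
        · refine le_trans (le_of_eq ?_) (Nat.zero_le 4)
          rw [card_eq_zero, filter_eq_empty_iff]
          rintro ⟨⟨x, y, z⟩, x', y', z'⟩ hq e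
          rw [hG, mem_filter] at hq
          simp only [hpt, hpl, Prod.mk.injEq] at e
          obtain ⟨⟨rfl, rfl, rfl⟩, rfl, rfl, rfl⟩ := e
          exact hg ⟨hq.2.2.2, hq.2.2.1⟩
    have hG4' : (G.card : ℝ) ≤ 4 * (((Q ×ˢ L).filter (fun q => onPl q.1 q.2)).card : ℝ) := by exact_mod_cast hG4
    have hs' : (((T ×ˢ T).filter (fun q => φ q.1 = φ q.2)).card : ℝ) ≤ G.card + 2 * (N * m) + 2 * (N * m) := by exact_mod_cast hsplit
    push_cast at hI
    have : ∀ x : ℝ, x = ((T ×ˢ T).filter (fun q => φ q.1 = φ q.2)).card → x ≤ 1000 * (N * √N) + 20 * (N * m) := by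
      rintro x rfl
      nlinarith
    apply this
    congr!
  · have : Q.image Prod.fst ⊆ X := by
      intro x hx
      rw [hQ, hT] at hx
      simp only [mem_image, mem_product, hpt] at hx
      obtain ⟨_, ⟨q, hq, rfl⟩, rfl⟩ := hx
      exact hq.1
    have := card_le_card this
    have h3 : (Q.image Prod.fst).card ≤ 2 * m := by omega
    convert h3
  · intro π hπ x0
    rw [hL, mem_image] at hπ
    obtain ⟨⟨x', y, z⟩, -, rfl⟩ := hπ
    simp only [hpl]
    have hcc := conic_count Y Z m hY hZ c s2 (s1 + x' * a) t2 (t1 + x' * b)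
      (r2 * x' ^ 2 + r1 * x' - ψ y z - (a * y + b * z) * x0 - (r2 * x0 ^ 2 + r1 * x0)) ?_
    · refine le_trans (le_trans (card_le_card ?_) (card_image_le (f := fun q : ZMod p × ZMod p => pt x0 q.1 q.2))) hcc
      intro q hq
      rw [mem_filter, hQ, mem_image] at hq
      obtain ⟨⟨⟨x, y', z'⟩, hq1, rfl⟩, hq2, hq3⟩ := hq
      have hx0 : x = x0 := by rw [← hq3, hpt]
      subst hx0
      refine mem_image.2 ⟨(y', z'), ?_, rfl⟩
      rw [hT] at hq1
      simp only [mem_product] at hq1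
      refine (@mem_filter _ _ _ _ _).2 ?_
      rw [mem_product]
      refine ⟨hq1.2, ?_⟩
      simp only [onPl, hpt] at hq2
      have e : ψ y' z' = c * y' * z' + s2 * y' ^ 2 + s1 * y' + t2 * z' ^ 2 + t1 * z' := by rw [hψ]
      simp only
      linear_combination -hq2 - e
    · rintro ⟨rfl, rfl, h1, rfl, h2⟩
      apply hnd
      refine ⟨by ring, ?_, by ring⟩
      linear_combination a * h2 - b * h1

end CoreB

open Finset

section Final
open Classical

/-- the quadratic part is a polynomial in one linear form -/
def Spec {F : Type*} [Field F] (a b c r2 r1 s2 s1 t2 t1 : F) : Prop :=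
  ∃ g2 g1 h k l : F, a = 2 * g2 * h * k ∧ b = 2 * g2 * h * l ∧ c = 2 * g2 * k * l ∧
    r2 = g2 * h ^ 2 ∧ s2 = g2 * k ^ 2 ∧ t2 = g2 * l ^ 2 ∧ r1 = g1 * h ∧ s1 = g1 * k ∧ t1 = g1 * l

theorem degen {F : Type*} [Field F] (a b c r2 r1 s2 s1 t2 t1 : F) (ha : a ≠ 0) (h2 : (2 : F) ≠ 0)
    (d1 : c * a = 2 * s2 * b ∧ t1 * a = s1 * b ∧ t2 * a ^ 2 = s2 * b ^ 2)
    (d2 : b * a = 2 * r2 * c ∧ t1 * a = r1 * c ∧ t2 * a ^ 2 = r2 * c ^ 2)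
    (hz : ¬ (b = 0 ∧ c = 0 ∧ t2 = 0 ∧ t1 = 0)) : Spec a b c r2 r1 s2 s1 t2 t1 := by
  obtain ⟨d1, d3, d4⟩ := d1
  obtain ⟨d5, d6, d7⟩ := d2
  have hb : b ≠ 0 := by
    rintro rfl
    apply hz
    have hc : c = 0 := by simpa [ha] using d1
    refine ⟨rfl, hc, ?_, ?_⟩
    · simpa [ha] using d4
    · simpa [ha] using d3
  have hc : c ≠ 0 := by
    rintro rfl
    apply hb
    simpa [ha] using d5
  refine ⟨1 / (2 * a * b * c), t1 / (b * c), a * b, a * c, b * c, ?_, ?_, ?_, ?_, ?_, ?_, ?_, ?_, ?_⟩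
  · field_simp
  · field_simp
  · field_simp
  · field_simp; linear_combination -d5
  · field_simp; linear_combination -d1
  · field_simp; 
    apply mul_left_cancel₀ ha
    linear_combination 2 * d4 - b * d1
  · field_simp; linear_combination -d6
  · field_simp; linear_combination -d3
  · field_simp

theorem count_le {F : Type*} [DecidableEq F] (φ φ' : F × F × F → F) (S S' : Finset (F × F × F))
    (e : F × F × F → F × F × F) (he : Function.Injective e) (hS : ∀ q ∈ S, e q ∈ S')
    (hφ : ∀ q, φ' (e q) = φ q) :
    ((S ×ˢ S).filter (fun q => φ q.1 = φ q.2)).card ≤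
    ((S' ×ˢ S').filter (fun q => φ' q.1 = φ' q.2)).card := by
  refine Finset.card_le_card_of_injOn (fun q => (e q.1, e q.2)) ?_ ?_
  · intro q hq
    simp only [coe_filter, mem_product, Set.mem_ofPred_eq] at hq ⊢
    rw [hφ, hφ]
    exact ⟨⟨hS _ hq.1.1, hS _ hq.1.2⟩, hq.2⟩
  · intro q _ q' _ h
    simp only [Prod.mk.injEq] at h
    exact Prod.ext (he h.1) (he h.2)

theorem core2 (p : ℕ) (hp : p.Prime) [Fact p.Prime] (h2 : (2 : ZMod p) ≠ 0)
    (a b c r2 r1 s2 s1 t2 t1 : ZMod p) (ha : a ≠ 0)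
    (hsp : ¬ Spec a b c r2 r1 s2 s1 t2 t1) (hz : ¬ (b = 0 ∧ c = 0 ∧ t2 = 0 ∧ t1 = 0))
    (X Y Z : Finset (ZMod p)) (m : ℕ) (hX : X.card ≤ m) (hY : Y.card ≤ m) (hZ : Z.card ≤ m)
    (hXZ : X.card * Z.card ≤ Y.card * m) (hYZ : Y.card * Z.card ≤ X.card * m)
    (N : ℕ) (hNe : N = X.card * Y.card * Z.card) (hN : N ≤ p ^ 2) :
    ((((X ×ˢ Y ×ˢ Z) ×ˢ (X ×ˢ Y ×ˢ Z)).filter (fun q =>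
      phi a b c r2 r1 s2 s1 t2 t1 q.1 = phi a b c r2 r1 s2 s1 t2 t1 q.2)).card : ℝ)
      ≤ 1000 * (N * √N) + 20 * (N * m) := by
  by_cases d1 : c * a = 2 * s2 * b ∧ t1 * a = s1 * b ∧ t2 * a ^ 2 = s2 * b ^ 2
  · by_cases d2 : b * a = 2 * r2 * c ∧ t1 * a = r1 * c ∧ t2 * a ^ 2 = r2 * c ^ 2
    · exact absurd (degen a b c r2 r1 s2 s1 t2 t1 ha h2 d1 d2 hz) hsp
    · have := core p hp a c b s2 s1 r2 r1 t2 t1 ha d2 Y X Z m hY hX hZ hYZ N (by rw [hNe]; ring) hN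
      refine le_trans ?_ this
      norm_cast
      refine count_le _ _ _ _ (fun q => (q.2.1, q.1, q.2.2)) ?_ ?_ ?_
      · rintro ⟨x, y, z⟩ ⟨x', y', z'⟩ h
        simp only [Prod.mk.injEq] at h ⊢
        tauto
      · intro q hq
        simp only [mem_product] at hq ⊢
        tauto
      · intro q
        simp only [phi]
        ring
  · exact core p hp a b c r2 r1 s2 s1 t2 t1 ha d1 X Y Z m hX hY hZ hXZ N hNe hN

theorem core3 (p : ℕ) (hp : p.Prime) [Fact p.Prime] (h2 : (2 : ZMod p) ≠ 0)
    (a b c r2 r1 s2 s1 t2 t1 : ZMod p) (hmix : ¬ (a = 0 ∧ b = 0 ∧ c = 0))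
    (hsp : ¬ Spec a b c r2 r1 s2 s1 t2 t1)
    (hx : ¬ (a = 0 ∧ b = 0 ∧ r2 = 0 ∧ r1 = 0)) (hy : ¬ (a = 0 ∧ c = 0 ∧ s2 = 0 ∧ s1 = 0))
    (hz : ¬ (b = 0 ∧ c = 0 ∧ t2 = 0 ∧ t1 = 0))
    (A B C : Finset (ZMod p)) (hAB : A.card = B.card) (hBC : B.card ≤ C.card)
    (N : ℕ) (hNe : N = A.card * B.card * C.card) (hN : N ≤ p ^ 2) :
    ((((A ×ˢ B ×ˢ C) ×ˢ (A ×ˢ B ×ˢ C)).filter (fun q =>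
      phi a b c r2 r1 s2 s1 t2 t1 q.1 = phi a b c r2 r1 s2 s1 t2 t1 q.2)).card : ℝ)
      ≤ 1000 * (N * √N) + 20 * (N * C.card) := by
  have hAC : A.card ≤ C.card := hAB ▸ hBC
  by_cases ha : a = 0
  · by_cases hb : b = 0
    · have hc : c ≠ 0 := fun hc => hmix ⟨ha, hb, hc⟩
      have := core2 p hp h2 c a b s2 s1 t2 t1 r2 r1 hc ?_ (by tauto) B C A C.card hBC le_rfl hAC
        (by rw [hAB]; nlinarith) (by rw [hAB]; nlinarith) N (by rw [hNe]; ring) hN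
      · refine le_trans ?_ this
        norm_cast
        refine count_le _ _ _ _ (fun q => (q.2.1, q.2.2, q.1)) ?_ ?_ ?_
        · rintro ⟨x, y, z⟩ ⟨x', y', z'⟩ h
          simp only [Prod.mk.injEq] at h ⊢
          tauto
        · intro q hq
          simp only [mem_product] at hq ⊢
          tauto
        · intro q
          simp only [phi]
          ring
      · rintro ⟨g2, g1, h, k, l, e1, e2, e3, e4, e5, e6, e7, e8, e9⟩
        exact hsp ⟨g2, g1, l, h, k, by linear_combination e2, by linear_combination e3,
          by linear_combination e1, by linear_combination e6, by linear_combination e4,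
          by linear_combination e5, e9, e7, e8⟩
    · have := core2 p hp h2 b a c r2 r1 t2 t1 s2 s1 hb ?_ (by tauto) A C B C.card hAC le_rfl hBC
        (by rw [hAB]; nlinarith) (by rw [hAB]; nlinarith) N (by rw [hNe]; ring) hN
      · refine le_trans ?_ this
        norm_cast
        refine count_le _ _ _ _ (fun q => (q.1, q.2.2, q.2.1)) ?_ ?_ ?_
        · rintro ⟨x, y, z⟩ ⟨x', y', z'⟩ h
          simp only [Prod.mk.injEq] at h ⊢
          tauto
        · intro q hq
          simp only [mem_product] at hq ⊢
          tauto
        · intro q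
          simp only [phi]
          ring
      · rintro ⟨g2, g1, h, k, l, e1, e2, e3, e4, e5, e6, e7, e8, e9⟩
        exact hsp ⟨g2, g1, h, l, k, by linear_combination e2, by linear_combination e1,
          by linear_combination e3, by linear_combination e4, by linear_combination e6,
          by linear_combination e5, e7, e9, e8⟩
  · exact core2 p hp h2 a b c r2 r1 s2 s1 t2 t1 ha hsp hz A B C C.card hAC hBC le_rfl
      (by rw [hAB]) (by rw [hAB]) N hNe hN

theorem quad_form {F : Type*} [Field F] (f : MvPolynomial (Fin 3) F) (hf : f.totalDegree ≤ 2) :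
    ∃ a b c r2 r1 s2 s1 t2 t1 d : F, f =
      MvPolynomial.C a * MvPolynomial.X 0 * MvPolynomial.X 1 +
      MvPolynomial.C b * MvPolynomial.X 0 * MvPolynomial.X 2 +
      MvPolynomial.C c * MvPolynomial.X 1 * MvPolynomial.X 2 +
      MvPolynomial.C r2 * MvPolynomial.X 0 ^ 2 + MvPolynomial.C r1 * MvPolynomial.X 0 +
      MvPolynomial.C s2 * MvPolynomial.X 1 ^ 2 + MvPolynomial.C s1 * MvPolynomial.X 1 +
      MvPolynomial.C t2 * MvPolynomial.X 2 ^ 2 + MvPolynomial.C t1 * MvPolynomial.X 2 +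
      MvPolynomial.C d := by
  rw [f.as_sum]
  have : ∀ m ∈ f.support, m 0 + m 1 + m 2 ≤ 2 := by
    intro m hm
    have := (MvPolynomial.le_totalDegree hm).trans hf
    rwa [Finsupp.sum_fintype _ _ (fun _ => rfl), Fin.sum_univ_three] at this
  revert this
  generalize f.support = S
  intro this
  induction S using Finset.induction_on with
  | empty => exact ⟨0, 0, 0, 0, 0, 0, 0, 0, 0, 0, by simp⟩
  | insert m s hm ih =>
    rw [Finset.sum_insert hm]
    obtain ⟨a, b, c, r2, r1, s2, s1, t2, t1, d, h⟩ := ih (fun m' hm' => this m' (mem_insert_of_mem hm'))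
    rw [h]
    have hm2 := this m (mem_insert_self _ _)
    have e : MvPolynomial.monomial m (MvPolynomial.coeff m f) = MvPolynomial.C (MvPolynomial.coeff m f) * (MvPolynomial.X 0 ^ (m 0) * MvPolynomial.X 1 ^ (m 1) * MvPolynomial.X 2 ^ (m 2)) := by
      rw [MvPolynomial.monomial_eq, Finsupp.prod_fintype _ _ (fun _ => pow_zero _), Fin.prod_univ_three]
    rw [e]
    generalize MvPolynomial.coeff m f = w
    generalize m 0 = i at *
    generalize m 1 = j at *
    generalize m 2 = k at *
    have hi : i ≤ 2 := by omega
    have hj : j ≤ 2 := by omega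
    have hk : k ≤ 2 := by omega
    refine ⟨a + if i = 1 ∧ j = 1 then w else 0, b + if i = 1 ∧ k = 1 then w else 0,
      c + if j = 1 ∧ k = 1 then w else 0, r2 + if i = 2 then w else 0,
      r1 + if i = 1 ∧ j = 0 ∧ k = 0 then w else 0, s2 + if j = 2 then w else 0,
      s1 + if j = 1 ∧ i = 0 ∧ k = 0 then w else 0, t2 + if k = 2 then w else 0,
      t1 + if k = 1 ∧ i = 0 ∧ j = 0 then w else 0, d + if i = 0 ∧ j = 0 ∧ k = 0 then w else 0, ?_⟩
    simp only [map_add]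
    interval_cases i <;> interval_cases j <;> interval_cases k <;>
      first
      | (exfalso; omega)
      | (simp only [if_true, if_false, true_and, and_true, and_self, OfNat.ofNat_ne_zero, OfNat.zero_ne_ofNat, zero_ne_one, one_ne_zero,
          false_and, and_false, OfNat.ofNat_ne_one, OfNat.one_ne_ofNat, map_zero, pow_zero, pow_one]; ring)

theorem supp_form {F : Type*} [Field F] (i j k : Fin 3) (hij : i ≠ j) (hik : i ≠ k) (u v w v' w' d : F) :
    MvPolynomial.C u * MvPolynomial.X j * MvPolynomial.X k + MvPolynomial.C v * MvPolynomial.X j ^ 2 +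
    MvPolynomial.C w * MvPolynomial.X j + MvPolynomial.C v' * MvPolynomial.X k ^ 2 +
    MvPolynomial.C w' * MvPolynomial.X k + MvPolynomial.C d ∈
      MvPolynomial.supported F ({i}ᶜ : Set (Fin 3)) := by
  have hX : ∀ j : Fin 3, i ≠ j → (MvPolynomial.X j : MvPolynomial (Fin 3) F) ∈
      MvPolynomial.supported F ({i}ᶜ : Set (Fin 3)) := by
    intro j hij
    rw [MvPolynomial.X_mem_supported]
    exact fun h => hij h.symm
  have hC : ∀ w : F, (MvPolynomial.C w : MvPolynomial (Fin 3) F) ∈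
      MvPolynomial.supported F ({i}ᶜ : Set (Fin 3)) := by
    intro w
    exact Subalgebra.algebraMap_mem _ w
  have hj := hX j hij
  have hk := hX k hik
  exact add_mem (add_mem (add_mem (add_mem (add_mem (mul_mem (mul_mem (hC _) hj) hk)
    (mul_mem (hC _) (pow_mem hj 2))) (mul_mem (hC _) hj)) (mul_mem (hC _) (pow_mem hk 2)))
    (mul_mem (hC _) hk)) (hC _)

end Final

theorem stmt_16 :
    ∃ c C : ℝ, 0 < c ∧ 0 < C ∧ ∀ (p : ℕ), p.Prime → 2 < p →
      ∀ (f : MvPolynomial (Fin 3) (ZMod p)), f.totalDegree = 2 →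
        (∀ i : Fin 3, i ∈ f.vars) →
        (¬ ∃ g h k l : Polynomial (ZMod p),
          f = Polynomial.aeval (Polynomial.aeval (MvPolynomial.X 0) h +
                Polynomial.aeval (MvPolynomial.X 1) k +
                Polynomial.aeval (MvPolynomial.X 2) l) g) →
      ∀ A B C' : Finset (ZMod p), A.card = B.card → B.card ≤ C'.card →
        (A.card : ℝ) * B.card * C'.card ≤ c * (p : ℝ) ^ 2 →
      ((((A ×ˢ B ×ˢ C') ×ˢ (A ×ˢ B ×ˢ C')).filter
          (fun q => MvPolynomial.eval ![q.1.1, q.1.2.1, q.1.2.2] f =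
            MvPolynomial.eval ![q.2.1, q.2.2.1, q.2.2.2] f)).card : ℝ) ≤
        C * (((A.card : ℝ) * B.card * C'.card) ^ ((3 : ℝ) / 2) +
          (A.card : ℝ) * B.card * (C'.card : ℝ) ^ 2) := by
  refine ⟨1, 1000, one_pos, by norm_num, ?_⟩
  intro p hp hp2 f hf hvars hng A B C' hAB hBC hsz
  haveI : Fact p.Prime := ⟨hp⟩
  have h2 : (2 : ZMod p) ≠ 0 := by
    intro h
    have : ((2 : ℕ) : ZMod p) = 0 := by exact_mod_cast h
    rw [ZMod.natCast_eq_zero_iff] at this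
    exact absurd (Nat.le_of_dvd (by norm_num) this) (by omega)
  obtain ⟨a, b, c, r2, r1, s2, s1, t2, t1, d, hfe⟩ := quad_form f hf.le
  obtain ⟨N, hN⟩ : ∃ N, N = A.card * B.card * C'.card := ⟨_, rfl⟩
  have hNp : N ≤ p ^ 2 := by
    rw [one_mul] at hsz
    rw [hN]
    exact_mod_cast hsz
  have hsupp : ∀ i : Fin 3, f ∉ MvPolynomial.supported (ZMod p) ({i}ᶜ : Set (Fin 3)) := by
    intro i hi
    rw [MvPolynomial.mem_supported] at hi
    exact hi (mem_coe.2 (hvars i)) rfl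
  have key := core3 p hp h2 a b c r2 r1 s2 s1 t2 t1 ?_ ?_ ?_ ?_ ?_ A B C' hAB hBC N hN hNp
  · have e : ∀ q : ZMod p × ZMod p × ZMod p, MvPolynomial.eval ![q.1, q.2.1, q.2.2] f =
        phi a b c r2 r1 s2 s1 t2 t1 q + d := by
      intro q
      rw [hfe]
      simp [phi]
      ring
    simp only [e, add_left_inj]
    have e3 : ((A.card : ℝ) * B.card * C'.card) ^ ((3 : ℝ) / 2) = N * √N := by
      have : (A.card : ℝ) * B.card * C'.card = N := by rw [hN]; push_cast; ring
      rw [this, Real.sqrt_eq_rpow]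
      rcases Nat.eq_zero_or_pos N with h | h
      · rw [h]; norm_num
      · rw [show (3:ℝ)/2 = 1 + 1/2 by norm_num, Real.rpow_add (by exact_mod_cast h), Real.rpow_one]
    rw [e3]
    refine key.trans ?_
    have : (N : ℝ) * C'.card = (A.card : ℝ) * B.card * (C'.card : ℝ) ^ 2 := by
      rw [hN]; push_cast; ring
    rw [← this]
    have : (0:ℝ) ≤ N * C'.card := by positivity
    nlinarith
  · rintro ⟨rfl, rfl, rfl⟩
    apply hng
    refine ⟨Polynomial.X + Polynomial.C d, Polynomial.C r2 * Polynomial.X ^ 2 + Polynomial.C r1 * Polynomial.X,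
      Polynomial.C s2 * Polynomial.X ^ 2 + Polynomial.C s1 * Polynomial.X,
      Polynomial.C t2 * Polynomial.X ^ 2 + Polynomial.C t1 * Polynomial.X, ?_⟩
    rw [hfe]
    simp [MvPolynomial.algebraMap_eq]
    ring
  · rintro ⟨g2, g1, h, k, l, rfl, rfl, rfl, rfl, rfl, rfl, rfl, rfl, rfl⟩
    apply hng
    refine ⟨Polynomial.C g2 * Polynomial.X ^ 2 + Polynomial.C g1 * Polynomial.X + Polynomial.C d,
      Polynomial.C h * Polynomial.X, Polynomial.C k * Polynomial.X, Polynomial.C l * Polynomial.X, ?_⟩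
    have hC2 : (MvPolynomial.C (2 : ZMod p) : MvPolynomial (Fin 3) (ZMod p)) = 2 := map_ofNat _ 2
    rw [hfe]
    simp [MvPolynomial.algebraMap_eq, hC2]
    ring
  · rintro ⟨rfl, rfl, rfl, rfl⟩
    apply hsupp 0
    rw [hfe]
    simp only [map_zero, zero_mul, zero_add, add_zero]
    exact supp_form 0 1 2 (by decide) (by decide) _ _ _ _ _ _
  · rintro ⟨rfl, rfl, rfl, rfl⟩
    apply hsupp 1
    rw [hfe]
    simp only [map_zero, zero_mul, zero_add, add_zero]
    exact supp_form 1 0 2 (by decide) (by decide) _ _ _ _ _ _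
  · rintro ⟨rfl, rfl, rfl, rfl⟩
    apply hsupp 2
    rw [hfe]
    simp only [map_zero, zero_mul, zero_add, add_zero]
    exact supp_form 2 0 1 (by decide) (by decide) _ _ _ _ _ _
end

section
/- Let p > 2 be prime and let f(x,y) = ax^2 + by^2 + cxy + dx + ey ∈ F_p[x,y] with a ≠ 0, such that f is not of the form g(αx + βy) for any univariate g ∈ F_p[t] and α,β ∈ F_p. Then the polynomial f'(x,y,z) := f(z - x, y) is not of the form g'(h'(x) + k'(y) + l'(z)) for any univariate polynomials g', h', k', l' over F_p. -/
open MvPolynomial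

theorem stmt_17 (p : ℕ) (hp : p.Prime) (hp2 : 2 < p)
    (a b c d e : ZMod p) (ha : a ≠ 0)
    (f : MvPolynomial (Fin 2) (ZMod p))
    (hf : f = C a * X 0 ^ 2 + C b * X 1 ^ 2 + C c * X 0 * X 1 + C d * X 0 + C e * X 1)
    (hnot : ¬ ∃ (g : Polynomial (ZMod p)) (α β : ZMod p),
      f = Polynomial.aeval (C α * X 0 + C β * X 1) g)
    (f' : MvPolynomial (Fin 3) (ZMod p))
    (hf' : f' = C a * (X 2 - X 0) ^ 2 + C b * X 1 ^ 2 + C c * (X 2 - X 0) * X 1 +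
      C d * (X 2 - X 0) + C e * X 1) :
    ¬ ∃ g' h' k' l' : Polynomial (ZMod p),
      f' = Polynomial.aeval (Polynomial.aeval (X 0) h' + Polynomial.aeval (X 1) k' +
        Polynomial.aeval (X 2) l') g' := by
  haveI : Fact p.Prime := ⟨hp⟩
  have h2 : (2 : ZMod p) ≠ 0 := by
    intro h
    have h' : ((2 : ℕ) : ZMod p) = 0 := by exact_mod_cast h
    rw [ZMod.natCast_eq_zero_iff] at h'
    exact absurd (Nat.le_of_dvd (by norm_num) h') (by omega)
  rintro ⟨g, h, k, l, hg⟩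
  set s : MvPolynomial (Fin 3) (ZMod p) := Polynomial.aeval (X 0) h + Polynomial.aeval (X 1) k +
        Polynomial.aeval (X 2) l with hs
  set G := Polynomial.aeval s (Polynomial.derivative g) with hG
  have C2 : (C 2 : MvPolynomial (Fin 3) (ZMod p)) = 2 := map_ofNat C 2
  have e0 : pderiv 0 f' = G * Polynomial.aeval (X 0) (Polynomial.derivative h) := by
    rw [hg, Derivation.map_aeval, hs]
    simp [Derivation.map_aeval, pderiv_X, Pi.single_apply, hG, hs]
  have e1 : pderiv 1 f' = G * Polynomial.aeval (X 1) (Polynomial.derivative k) := by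
    rw [hg, Derivation.map_aeval, hs]
    simp [Derivation.map_aeval, pderiv_X, Pi.single_apply, hG, hs]
  have e2 : pderiv 2 f' = G * Polynomial.aeval (X 2) (Polynomial.derivative l) := by
    rw [hg, Derivation.map_aeval, hs]
    simp [Derivation.map_aeval, pderiv_X, Pi.single_apply, hG, hs]
  have d0 : pderiv 0 f' = -(C (2 * a) * (X 2 - X 0) + C c * X 1 + C d) := by
    rw [hf']
    simp [pderiv_X, Pi.single_apply, Derivation.leibniz, Derivation.leibniz_pow]
    rw [C2]
    ring
  have d1 : pderiv 1 f' = C (2 * b) * X 1 + C c * (X 2 - X 0) + C e := by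
    rw [hf']
    simp [pderiv_X, Pi.single_apply, Derivation.leibniz, Derivation.leibniz_pow]
    rw [C2]
    ring
  have d2 : pderiv 2 f' = C (2 * a) * (X 2 - X 0) + C c * X 1 + C d := by
    rw [hf']
    simp [pderiv_X, Pi.single_apply, Derivation.leibniz, Derivation.leibniz_pow]
    rw [C2]
    ring
  rw [d0] at e0
  rw [d1] at e1
  rw [d2] at e2
  have ev : ∀ (v : Fin 3 → ZMod p) (i : Fin 3) (q : Polynomial (ZMod p)),
      eval v (Polynomial.aeval (X i) q) = q.eval (v i) := by
    intro v i q
    induction q using Polynomial.induction_on' with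
    | add p q hp hq => simp [hp, hq]
    | monomial n r => simp [Polynomial.aeval_monomial, algebraMap_eq]
  have E1 : ∀ x y z : ZMod p, 2 * b * y + c * (z - x) + e =
      eval ![x, y, z] G * (Polynomial.derivative k).eval y := by
    intro x y z
    have := congrArg (eval ![x, y, z]) e1
    rw [map_mul _ G, ev] at this
    simpa using this
  have E2 : ∀ x y z : ZMod p, 2 * a * (z - x) + c * y + d =
      eval ![x, y, z] G * (Polynomial.derivative l).eval z := by
    intro x y z
    have := congrArg (eval ![x, y, z]) e2
    rw [map_mul _ G, ev] at this
    simpa using this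
  have h2a : 2 * a ≠ 0 := mul_ne_zero h2 ha
  have G0 : G ≠ 0 := by
    intro h0
    have u := E2 0 0 0
    have v := E2 0 0 1
    rw [h0] at u v
    simp at u v
    rw [u] at v
    simp [h2, ha] at v
  have hl : Polynomial.aeval (X 0 : MvPolynomial (Fin 3) (ZMod p)) (Polynomial.derivative h) +
      Polynomial.aeval (X 2) (Polynomial.derivative l) = 0 := by
    apply mul_left_cancel₀ G0
    rw [mul_add, ← e0, ← e2]; ring
  obtain ⟨m, hm⟩ : ∃ m, ∀ z, (Polynomial.derivative l).eval z = m := by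
    refine ⟨-(Polynomial.derivative h).eval 0, fun z => ?_⟩
    have := congrArg (eval ![0, 0, z]) hl
    rw [map_add, ev, ev] at this
    simp at this
    linear_combination this
  simp only [hm] at E2
  have m0 : m ≠ 0 := by
    intro h0
    have u := E2 0 0 0
    have v := E2 0 0 1
    rw [h0] at u v
    apply h2a
    linear_combination v - u
  have key : ∀ x y z : ZMod p, (2 * a * (z - x) + c * y + d) * (Polynomial.derivative k).eval y
      = (2 * b * y + c * (z - x) + e) * m := by
    intro x y z
    rw [E1, E2]; ring
  have kc : ∀ y, 2 * a * (Polynomial.derivative k).eval y = c * m := by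
    intro y
    linear_combination key 0 y 1 - key 0 y 0
  set κ := (Polynomial.derivative k).eval 0 with hκ
  have k1 : (Polynomial.derivative k).eval 1 = κ := by
    apply mul_left_cancel₀ h2a
    rw [kc, kc]
  have q0 := key 0 0 0
  have q1 := key 0 1 0
  rw [k1] at q1
  rw [← hκ] at q0
  have q2 := kc 0
  rw [← hκ] at q2
  obtain ⟨r, hr⟩ : ∃ r, κ = r * m := ⟨κ / m, by field_simp⟩
  rw [hr] at q0 q1 q2
  have c1 : c = 2 * a * r := by
    apply mul_right_cancel₀ m0
    linear_combination -q2
  have c2 : e = d * r := by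
    apply mul_right_cancel₀ m0
    linear_combination -q0
  have c3 : b = a * r ^ 2 := by
    apply mul_left_cancel₀ h2
    apply mul_right_cancel₀ m0
    rw [c1, c2] at q1
    linear_combination -q1
  apply hnot
  refine ⟨Polynomial.C a * Polynomial.X ^ 2 + Polynomial.C d * Polynomial.X, 1, r, ?_⟩
  rw [hf, c3, c2, c1]
  simp [algebraMap_eq]
  have : (C 2 : MvPolynomial (Fin 2) (ZMod p)) = 2 := map_ofNat C 2
  rw [this]
  ring
end
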